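/- arXiv:1912.12921 — 6 statements merged into one kernel-verified Lean document; each statement's English description precedes it below -/
import Mathlib

section
/- Let G_b(V_0,E_0) be an undirected weighted graph on k vertices with adjacency matrix (w_{ij})_{k×k}, and let H_1,…,H_k be r_i-regular m-uniform hypergraphs on pairwise disjoint vertex sets. Let H be the m-uniform hypergraph constructed by taking G_b as backbone and the H_i as participants: the vertex set of H is ∪_{i=1}^k V_i, every edge of every H_i is kept, and for each graph edge {p,q} ∈ E_0 every m-element subset of V_p ∪ V_q intersecting both V_p and V_q is added as an edge of weight w_{pq}. Then for every eigenvalue λ of A_{H_p} that possesses l linearly independent eigenvectors orthogonal to the all-ones vector, λ − Σ_{q: {p,q}∈E_0} w_{pq}·d^{S_{{p,q}}(m)}_{pp} is an eigenvalue of A_H with multiplicity at least l. -/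
open scoped BigOperators Classical

/-- Adjacency matrix of a weighted hypergraph with edge set `E` and weight `W`:
`A i j = ∑_{e ∈ E, i,j ∈ e} W(e)/(|e|-1)` for `i ≠ j`, and `A i i = 0`. -/
noncomputable def adjW {V : Type*} [DecidableEq V]
    (E : Finset (Finset V)) (W : Finset V → ℝ) : Matrix V V ℝ :=
  fun i j => if i = j then 0 else
    ∑ e ∈ E.filter (fun e => i ∈ e ∧ j ∈ e), W e / ((e.card : ℝ) - 1)

section GraphBackbone

variable {k : ℕ} (nn : Fin k → ℕ)

/-- The disjoint union `V = V₁ ∪ ⋯ ∪ V_k` of the vertex sets of the participants. -/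
abbrev JV (nn : Fin k → ℕ) := Σ i : Fin k, Fin (nn i)

/-- The embedding of `V_i` into the disjoint union. -/
def semb (i : Fin k) : Fin (nn i) ↪ JV nn :=
  ⟨fun v => ⟨i, v⟩, fun a b h => by simpa using h⟩

/-- The edges of the participants, viewed inside the disjoint union. -/
noncomputable def partEdges (Ed : ∀ i : Fin k, Finset (Finset (Fin (nn i)))) :
    Finset (Finset (JV nn)) :=
  Finset.univ.biUnion (fun i => (Ed i).image (fun e => e.map (semb nn i)))

/-- The new edges created by a backbone graph edge `{p,q}`: all `m`-element subsets of
`V_p ∪ V_q` intersecting both `V_p` and `V_q` (equivalently, whose set of components is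
exactly `{p, q}`). -/
noncomputable def pairNewEdges (m : ℕ) (p q : Fin k) : Finset (Finset (JV nn)) :=
  Finset.univ.filter (fun f : Finset (JV nn) =>
    f.card = m ∧ f.image Sigma.fst = {p, q})

/-- The edge set of the hypergraph built on a backbone graph `G`: participant edges
together with, for each graph edge `{p,q}`, all new edges of the pair `{p,q}`. -/
noncomputable def gbEdges (G : SimpleGraph (Fin k))
    (Ed : ∀ i : Fin k, Finset (Finset (Fin (nn i)))) (m : ℕ) :
    Finset (Finset (JV nn)) :=
  partEdges nn Ed ∪
    Finset.univ.biUnion (fun pq : Fin k × Fin k =>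
      if G.Adj pq.1 pq.2 then pairNewEdges nn m pq.1 pq.2 else ∅)

/-- The weight function: participant edges keep their weight, a new edge coming from
the (unique) backbone edge `{p,q}` gets weight `w p q`. -/
noncomputable def gbWeight (G : SimpleGraph (Fin k))
    (Ed : ∀ i : Fin k, Finset (Finset (Fin (nn i))))
    (Wt : ∀ i : Fin k, Finset (Fin (nn i)) → ℝ)
    (w : Fin k → Fin k → ℝ) (f : Finset (JV nn)) : ℝ :=
  if f ∈ partEdges nn Ed then
    ∑ i : Fin k, ∑ e ∈ (Ed i).filter (fun e => e.map (semb nn i) = f), Wt i e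
  else
    ∑ p : Fin k, ∑ q : Fin k,
      if p < q ∧ G.Adj p q ∧ f.image Sigma.fst = {p, q} then w p q else 0

end GraphBackbone

section BackboneSpectrum

variable {k : ℕ} {nn : Fin k → ℕ}

/-- The weight that the backbone graph assigns to a set of vertices according to the
components that it meets. -/
noncomputable def backboneWeight (G : SimpleGraph (Fin k)) (w : Fin k → Fin k → ℝ)
    (f : Finset (JV nn)) : ℝ :=
  ∑ p : Fin k, ∑ q : Fin k,
    if p < q ∧ G.Adj p q ∧ f.image Sigma.fst = {p, q} then w p q else 0

theorem backboneWeight_eq_zero {G : SimpleGraph (Fin k)} {w : Fin k → Fin k → ℝ}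
    {f : Finset (JV nn)} (h : ∀ a b, G.Adj a b → f.image Sigma.fst ≠ {a, b}) :
    backboneWeight G w f = 0 :=
  Finset.sum_eq_zero fun a _ => Finset.sum_eq_zero fun b _ =>
    if_neg fun hab => h a b hab.2.1 hab.2.2

theorem backboneWeight_eq_of_lt {G : SimpleGraph (Fin k)} {w : Fin k → Fin k → ℝ}
    {f : Finset (JV nn)} {a b : Fin k} (hlt : a < b) (hab : G.Adj a b)
    (hf : f.image Sigma.fst = {a, b}) : backboneWeight G w f = w a b := by
  have huniq : ∀ c d : Fin k, c < d → ({a, b} : Finset (Fin k)) = {c, d} →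
      c = a ∧ d = b := by
    intro c d hcd h
    have h1 : c ∈ ({a, b} : Finset (Fin k)) := by rw [h]; simp
    have h2 : d ∈ ({a, b} : Finset (Fin k)) := by rw [h]; simp
    simp only [Finset.mem_insert, Finset.mem_singleton] at h1 h2
    rcases h1 with rfl | rfl <;> rcases h2 with rfl | rfl <;> (simp_all; try omega)
  unfold backboneWeight
  rw [Finset.sum_eq_single a, Finset.sum_eq_single b, if_pos ⟨hlt, hab, hf⟩]
  · intro d _ hd
    exact if_neg fun h => hd (huniq a d h.1 (hf.symm.trans h.2.2)).2
  · simp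
  · intro c _ hc
    exact Finset.sum_eq_zero fun d _ =>
      if_neg fun h => hc (huniq c d h.1 (hf.symm.trans h.2.2)).1
  · simp

theorem backboneWeight_eq {G : SimpleGraph (Fin k)} {w : Fin k → Fin k → ℝ}
    (hw : ∀ p q, w p q = w q p) {f : Finset (JV nn)} {a b : Fin k} (hab : G.Adj a b)
    (hf : f.image Sigma.fst = {a, b}) : backboneWeight G w f = w a b := by
  rcases lt_or_gt_of_ne hab.ne with h | h
  · exact backboneWeight_eq_of_lt h hab hf
  · rw [hw a b]
    exact backboneWeight_eq_of_lt h hab.symm (by rw [hf, Finset.pair_comm])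

theorem backboneWeight_eq_sum {G : SimpleGraph (Fin k)} {w : Fin k → Fin k → ℝ}
    (hw : ∀ p q, w p q = w q p) {f : Finset (JV nn)} {p : Fin k}
    (hp : p ∈ f.image Sigma.fst) :
    backboneWeight G w f =
      ∑ q ∈ Finset.univ.filter (fun q => G.Adj p q),
        if f.image Sigma.fst = {p, q} then w p q else 0 := by
  by_cases h : ∃ q, G.Adj p q ∧ f.image Sigma.fst = {p, q}
  · obtain ⟨q, hpq, hf⟩ := h
    rw [backboneWeight_eq hw hpq hf, Finset.sum_eq_single q, if_pos hf]
    · intro c hc hcq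
      refine if_neg fun h => ?_
      have h1 : c ∈ ({p, q} : Finset (Fin k)) := by rw [← hf, h]; simp
      have h2 : p ≠ c := (Finset.mem_filter.1 hc).2.ne
      simp only [Finset.mem_insert, Finset.mem_singleton] at h1
      exact h1.elim (fun h => h2 h.symm) hcq
    · intro h
      exact absurd (Finset.mem_filter.2 ⟨Finset.mem_univ _, hpq⟩) h
  · push Not at h
    rw [backboneWeight_eq_zero, Finset.sum_eq_zero]
    · intro q hq
      exact if_neg (h q (Finset.mem_filter.1 hq).2)
    · intro a b hab hf
      have hp' := hp
      rw [hf] at hp'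
      simp only [Finset.mem_insert, Finset.mem_singleton] at hp'
      rcases hp' with rfl | rfl
      · exact h b hab hf
      · exact h a hab.symm (by rw [hf, Finset.pair_comm])

theorem backboneWeight_eq_zero_of_mem_partEdges {G : SimpleGraph (Fin k)}
    {w : Fin k → Fin k → ℝ} {Ed : ∀ i : Fin k, Finset (Finset (Fin (nn i)))}
    {f : Finset (JV nn)} (hf : f ∈ partEdges nn Ed) : backboneWeight G w f = 0 := by
  simp only [partEdges, Finset.mem_biUnion, Finset.mem_univ, true_and,
    Finset.mem_image] at hf
  obtain ⟨i, e, -, rfl⟩ := hf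
  refine backboneWeight_eq_zero fun a b hab h => hab.ne ?_
  have key : ∀ c ∈ ({a, b} : Finset (Fin k)), c = i := by
    intro c hc
    rw [← h] at hc
    simp only [Finset.mem_image, Finset.mem_map] at hc
    obtain ⟨_, ⟨y, -, rfl⟩, rfl⟩ := hc
    rfl
  rw [key a (by simp), key b (by simp)]

theorem backboneWeight_eq_zero_of_notMem_gbEdges {G : SimpleGraph (Fin k)}
    {w : Fin k → Fin k → ℝ} {Ed : ∀ i : Fin k, Finset (Finset (Fin (nn i)))}
    {f : Finset (JV nn)} (hf : f ∉ gbEdges nn G Ed f.card) :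
    backboneWeight G w f = 0 := by
  refine backboneWeight_eq_zero fun a b hab h => hf ?_
  refine Finset.mem_union_right _ (Finset.mem_biUnion.2 ⟨(a, b), Finset.mem_univ _, ?_⟩)
  rw [if_pos hab]
  exact Finset.mem_filter.2 ⟨Finset.mem_univ _, rfl, h⟩

theorem card_eq_of_mem_gbEdges {G : SimpleGraph (Fin k)}
    {Ed : ∀ i : Fin k, Finset (Finset (Fin (nn i)))} {m : ℕ} {f : Finset (JV nn)}
    (hf : f ∈ gbEdges nn G Ed m) (hpart : f ∉ partEdges nn Ed) : f.card = m := by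
  rcases Finset.mem_union.1 hf with h | h
  · exact absurd h hpart
  · obtain ⟨pq, -, h⟩ := Finset.mem_biUnion.1 h
    split_ifs at h
    · exact (Finset.mem_filter.1 h).2.1
    · simp at h

/-- The contribution of the backbone edges to the entries of the adjacency matrix. -/
noncomputable def backboneAdj (G : SimpleGraph (Fin k)) (w : Fin k → Fin k → ℝ) (m : ℕ)
    (a b : JV nn) : ℝ :=
  ∑ f : Finset (JV nn),
    if f.card = m ∧ a ∈ f ∧ b ∈ f then backboneWeight G w f / ((m : ℝ) - 1) else 0

theorem sum_partEdges (G : SimpleGraph (Fin k))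
    (Ed : ∀ i : Fin k, Finset (Finset (Fin (nn i)))) (w : Fin k → Fin k → ℝ)
    (F : Finset (JV nn) → ℝ) :
    ∑ f ∈ partEdges nn Ed, gbWeight nn G Ed (fun _ _ => (1 : ℝ)) w f * F f =
      ∑ i : Fin k, ∑ e ∈ Ed i, F (e.map (semb nn i)) := by
  have h1 : ∀ f ∈ partEdges nn Ed, gbWeight nn G Ed (fun _ _ => (1 : ℝ)) w f * F f =
      ∑ i : Fin k, ∑ e ∈ (Ed i).filter (fun e => e.map (semb nn i) = f),
        F (e.map (semb nn i)) := by
    intro f hf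
    rw [gbWeight, if_pos hf, Finset.sum_mul]
    refine Finset.sum_congr rfl fun i _ => ?_
    rw [Finset.sum_mul]
    refine Finset.sum_congr rfl fun e he => ?_
    rw [(Finset.mem_filter.1 he).2, one_mul]
  rw [Finset.sum_congr rfl h1, Finset.sum_comm]
  refine Finset.sum_congr rfl fun i _ => ?_
  simp_rw [Finset.sum_filter]
  rw [Finset.sum_comm]
  refine Finset.sum_congr rfl fun e he => ?_
  rw [Finset.sum_ite_eq, if_pos]
  exact Finset.mem_biUnion.2 ⟨i, Finset.mem_univ _, Finset.mem_image_of_mem _ he⟩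

theorem adjW_gbEdges (G : SimpleGraph (Fin k))
    (Ed : ∀ i : Fin k, Finset (Finset (Fin (nn i)))) (w : Fin k → Fin k → ℝ) (m : ℕ)
    {a b : JV nn} (hab : a ≠ b) :
    adjW (gbEdges nn G Ed m) (gbWeight nn G Ed (fun _ _ => (1 : ℝ)) w) a b =
      (∑ i : Fin k, ∑ e ∈ Ed i,
        if a ∈ e.map (semb nn i) ∧ b ∈ e.map (semb nn i) then
          1 / ((e.card : ℝ) - 1) else 0) + backboneAdj G w m a b := by
  have h1 := sum_partEdges G Ed w
    (fun f => if a ∈ f ∧ b ∈ f then 1 / ((f.card : ℝ) - 1) else 0)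
  simp only [Finset.card_map] at h1
  rw [← h1, adjW, if_neg hab, backboneAdj, Finset.sum_filter,
    ← Finset.univ_inter (gbEdges nn G Ed m), ← Finset.univ_inter (partEdges nn Ed),
    ← Finset.sum_ite_mem, ← Finset.sum_ite_mem, ← Finset.sum_add_distrib]
  refine Finset.sum_congr rfl fun f _ => ?_
  by_cases hP : a ∈ f ∧ b ∈ f
  · by_cases hf : f ∈ partEdges nn Ed
    · have hf' : f ∈ gbEdges nn G Ed m := Finset.mem_union_left _ hf
      simp [hP, hf, hf', backboneWeight_eq_zero_of_mem_partEdges hf, div_eq_mul_inv]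
    · have hW : gbWeight nn G Ed (fun _ _ => (1 : ℝ)) w f = backboneWeight G w f := by
        rw [gbWeight, if_neg hf, backboneWeight]
      by_cases hf' : f ∈ gbEdges nn G Ed m
      · have hc := card_eq_of_mem_gbEdges hf' hf
        simp [hP, hf, hf', hc, hW]
      · have h0 : f.card = m → backboneWeight G w f = 0 := by
          rintro rfl
          exact backboneWeight_eq_zero_of_notMem_gbEdges hf'
        simp +contextual [hP, hf, hf', h0]
  · simp [hP]

theorem backboneAdj_perm (G : SimpleGraph (Fin k)) (w : Fin k → Fin k → ℝ) (m : ℕ)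
    (σ : Equiv.Perm (JV nn)) (hσ : ∀ a, (σ a).1 = a.1) (a b : JV nn) :
    backboneAdj G w m (σ a) (σ b) = backboneAdj G w m a b := by
  unfold backboneAdj
  refine (Fintype.sum_equiv σ.finsetCongr _ _ fun f => ?_).symm
  have himg : (f.map σ.toEmbedding).image Sigma.fst = f.image Sigma.fst := by
    rw [Finset.map_eq_image, Finset.image_image]
    exact Finset.image_congr fun a _ => hσ a
  simp [Equiv.finsetCongr_apply, backboneWeight, himg]

theorem swap_fst {a b : JV nn} (h : a.1 = b.1) (c : JV nn) :
    (Equiv.swap a b c).1 = c.1 := by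
  rw [Equiv.swap_apply_def]
  split_ifs with h1 h2
  · rw [h1, h]
  · rw [h2, h]
  · rfl

theorem backboneAdj_eq_of_fst_eq (G : SimpleGraph (Fin k)) (w : Fin k → Fin k → ℝ)
    (m : ℕ) {a b c d : JV nn} (hac : a.1 = c.1) (hbd : b.1 = d.1) (hab : a ≠ b)
    (hcd : c ≠ d) : backboneAdj G w m a b = backboneAdj G w m c d := by
  have hb : (Equiv.swap a c b).1 = d.1 := (swap_fst hac b).trans hbd
  have hc : c ≠ Equiv.swap a c b := by
    intro h
    exact hab ((Equiv.swap a c).injective ((Equiv.swap_apply_left a c).trans h))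
  rw [← backboneAdj_perm G w m (Equiv.swap a c) (swap_fst hac) a b,
    Equiv.swap_apply_left,
    ← backboneAdj_perm G w m (Equiv.swap (Equiv.swap a c b) d) (swap_fst hb),
    Equiv.swap_apply_left, Equiv.swap_apply_of_ne_of_ne hc hcd]

theorem backboneAdj_eq_sum {G : SimpleGraph (Fin k)} {w : Fin k → Fin k → ℝ}
    (hw : ∀ p q, w p q = w q p) (m : ℕ) {p : Fin k} (u v : Fin (nn p)) :
    backboneAdj G w m (⟨p, u⟩ : JV nn) ⟨p, v⟩ =
      ∑ q ∈ Finset.univ.filter (fun q => G.Adj p q),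
        w p q * ((((pairNewEdges nn m p q).filter (fun e =>
          (⟨p, u⟩ : JV nn) ∈ e ∧ (⟨p, v⟩ : JV nn) ∈ e)).card : ℝ) / ((m : ℝ) - 1)) := by
  have h1 : ∀ f : Finset (JV nn),
      (if f.card = m ∧ (⟨p, u⟩ : JV nn) ∈ f ∧ (⟨p, v⟩ : JV nn) ∈ f then
        backboneWeight G w f / ((m : ℝ) - 1) else 0) =
      ∑ q ∈ Finset.univ.filter (fun q => G.Adj p q),
        if f ∈ (pairNewEdges nn m p q).filter (fun e =>
          (⟨p, u⟩ : JV nn) ∈ e ∧ (⟨p, v⟩ : JV nn) ∈ e) then w p q / ((m : ℝ) - 1)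
          else 0 := by
    intro f
    by_cases h : f.card = m ∧ (⟨p, u⟩ : JV nn) ∈ f ∧ (⟨p, v⟩ : JV nn) ∈ f
    · rw [if_pos h, backboneWeight_eq_sum hw (Finset.mem_image_of_mem Sigma.fst h.2.1),
        Finset.sum_div]
      refine Finset.sum_congr rfl fun q _ => ?_
      simp only [pairNewEdges, Finset.mem_filter, Finset.mem_univ, true_and, h, and_true]
      split_ifs <;> simp
    · rw [if_neg h, Finset.sum_eq_zero]
      intro q _
      refine if_neg fun hf => h ?_
      simp only [pairNewEdges, Finset.mem_filter, Finset.mem_univ, true_and] at hf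
      exact ⟨hf.1.1, hf.2⟩
  rw [backboneAdj, Finset.sum_congr rfl fun f _ => h1 f, Finset.sum_comm]
  refine Finset.sum_congr rfl fun q _ => ?_
  rw [Finset.sum_ite_mem, Finset.univ_inter, Finset.sum_const, nsmul_eq_mul]
  ring

theorem adjW_gbEdges_fiber (G : SimpleGraph (Fin k))
    (Ed : ∀ i : Fin k, Finset (Finset (Fin (nn i)))) (w : Fin k → Fin k → ℝ) (m : ℕ)
    {p : Fin k} {x y : Fin (nn p)} (hxy : x ≠ y) :
    adjW (gbEdges nn G Ed m) (gbWeight nn G Ed (fun _ _ => (1 : ℝ)) w)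
        (⟨p, x⟩ : JV nn) ⟨p, y⟩ =
      adjW (Ed p) (fun _ => (1 : ℝ)) x y + backboneAdj G w m (⟨p, x⟩ : JV nn) ⟨p, y⟩ := by
  have hmem : ∀ (z : Fin (nn p)) (e : Finset (Fin (nn p))),
      (⟨p, z⟩ : JV nn) ∈ e.map (semb nn p) ↔ z ∈ e :=
    fun z e => Finset.mem_map' (semb nn p)
  rw [adjW_gbEdges G Ed w m (by simpa using hxy), adjW, if_neg hxy, Finset.sum_filter,
    Finset.sum_eq_single p]
  · simp only [hmem]
  · intro i _ hip
    refine Finset.sum_eq_zero fun e _ => if_neg fun h => hip ?_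
    obtain ⟨z, -, hz⟩ := Finset.mem_map.1 h.1
    exact congrArg Sigma.fst hz
  · simp

theorem adjW_gbEdges_cross (G : SimpleGraph (Fin k))
    (Ed : ∀ i : Fin k, Finset (Finset (Fin (nn i)))) (w : Fin k → Fin k → ℝ) (m : ℕ)
    {i p : Fin k} (hip : i ≠ p) (x : Fin (nn i)) (y : Fin (nn p)) :
    adjW (gbEdges nn G Ed m) (gbWeight nn G Ed (fun _ _ => (1 : ℝ)) w)
        (⟨i, x⟩ : JV nn) ⟨p, y⟩ = backboneAdj G w m (⟨i, x⟩ : JV nn) ⟨p, y⟩ := by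
  rw [adjW_gbEdges G Ed w m (fun h => hip (congrArg Sigma.fst h)), add_eq_right]
  refine Finset.sum_eq_zero fun j _ => Finset.sum_eq_zero fun e _ =>
    if_neg fun h => hip ?_
  obtain ⟨z, -, hz⟩ := Finset.mem_map.1 h.1
  obtain ⟨z', -, hz'⟩ := Finset.mem_map.1 h.2
  exact (congrArg Sigma.fst hz).symm.trans (congrArg Sigma.fst hz')

theorem mulVec_extend_semb (A : Matrix (JV nn) (JV nn) ℝ) {p : Fin k}
    (φ : Fin (nn p) → ℝ) (a : JV nn) :
    A.mulVec (Function.extend (semb nn p) φ 0) a = ∑ y, A a ⟨p, y⟩ * φ y := by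
  rw [Matrix.mulVec, dotProduct]
  refine (Fintype.sum_of_injective (semb nn p) (semb nn p).injective _ _ ?_ ?_).symm
  · intro b hb
    rw [Function.extend_apply' _ _ _ hb, Pi.zero_apply, mul_zero]
  · intro y
    rw [(semb nn p).injective.extend_apply]
    rfl

theorem mulVec_adjW_gbEdges_extend (G : SimpleGraph (Fin k))
    (Ed : ∀ i : Fin k, Finset (Finset (Fin (nn i)))) (w : Fin k → Fin k → ℝ) (m : ℕ)
    {p : Fin k} {u v : Fin (nn p)} (huv : u ≠ v) {lam : ℝ} {φ : Fin (nn p) → ℝ}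
    (hφ : (adjW (Ed p) (fun _ => (1 : ℝ))).mulVec φ = lam • φ) (hsum : ∑ y, φ y = 0) :
    (adjW (gbEdges nn G Ed m) (gbWeight nn G Ed (fun _ _ => (1 : ℝ)) w)).mulVec
        (Function.extend (semb nn p) φ 0) =
      (lam - backboneAdj G w m (⟨p, u⟩ : JV nn) ⟨p, v⟩) •
        Function.extend (semb nn p) φ 0 := by
  ext ⟨i, x⟩
  rw [mulVec_extend_semb, Pi.smul_apply]
  by_cases hip : i = p
  · subst hip
    set D := backboneAdj G w m (⟨i, u⟩ : JV nn) ⟨i, v⟩ with hD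
    have hentry : ∀ y, adjW (gbEdges nn G Ed m)
        (gbWeight nn G Ed (fun _ _ => (1 : ℝ)) w) (⟨i, x⟩ : JV nn) ⟨i, y⟩ * φ y =
        adjW (Ed i) (fun _ => (1 : ℝ)) x y * φ y + D * φ y -
          if x = y then D * φ y else 0 := by
      intro y
      by_cases hxy : x = y
      · subst hxy
        simp [adjW]
      · have hxyD : backboneAdj G w m (⟨i, x⟩ : JV nn) ⟨i, y⟩ = D :=
          backboneAdj_eq_of_fst_eq G w m rfl rfl (by simpa using hxy) (by simpa using huv)
        rw [adjW_gbEdges_fiber G Ed w m hxy, if_neg hxy, hxyD]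
        ring
    have hx : ∑ y, adjW (Ed i) (fun _ => (1 : ℝ)) x y * φ y = lam * φ x := congrFun hφ x
    have hext : Function.extend (semb nn i) φ 0 (⟨i, x⟩ : JV nn) = φ x :=
      (semb nn i).injective.extend_apply φ 0 x
    rw [Finset.sum_congr rfl fun y _ => hentry y, Finset.sum_sub_distrib,
      Finset.sum_add_distrib, hx, ← Finset.mul_sum, hsum, hext, Finset.sum_ite_eq,
      if_pos (Finset.mem_univ x), smul_eq_mul]
    ring
  · have hne : ∀ y, (⟨i, x⟩ : JV nn) ≠ ⟨p, y⟩ := fun y h => hip (congrArg Sigma.fst h)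
    have hentry : ∀ y, adjW (gbEdges nn G Ed m)
        (gbWeight nn G Ed (fun _ _ => (1 : ℝ)) w) (⟨i, x⟩ : JV nn) ⟨p, y⟩ * φ y =
        backboneAdj G w m (⟨i, x⟩ : JV nn) ⟨p, u⟩ * φ y := fun y => by
      have hyu : backboneAdj G w m (⟨i, x⟩ : JV nn) ⟨p, y⟩ =
          backboneAdj G w m (⟨i, x⟩ : JV nn) ⟨p, u⟩ :=
        backboneAdj_eq_of_fst_eq G w m rfl rfl (hne y) (hne u)
      rw [adjW_gbEdges_cross G Ed w m hip, hyu]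
    have hext : Function.extend (semb nn p) φ 0 (⟨i, x⟩ : JV nn) = 0 :=
      Function.extend_apply' _ _ _ fun ⟨y, hy⟩ => hne y hy.symm
    rw [Finset.sum_congr rfl fun y _ => hentry y, ← Finset.mul_sum, hsum, hext, mul_zero,
      smul_zero]

end BackboneSpectrum

/-- let `G_b` be a weighted graph on `k` vertices with adjacency weights
`w`, and let `H_1,…,H_k` be `r_i`-regular `m`-uniform hypergraphs on disjoint vertex
sets.  Let `H` be the hypergraph with backbone `G_b` and participants `H_i`.  If `λ` is
an eigenvalue of `A_{H_p}` possessing `l` linearly independent eigenvectors orthogonal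
to the all-ones vector, then `λ - ∑_{q : {p,q} ∈ E₀} w p q · d^{S_{p,q}(m)}_{pp}` is an
eigenvalue of `A_H` with multiplicity at least `l`; here `d^{S_{p,q}(m)}_{pp}` is
`1/(m-1)` times the number of new edges of the pair `{p,q}` containing two fixed
distinct vertices `u ≠ v` of `V_p`. -/
theorem stmt_3 (k m : ℕ) (hm : 2 ≤ m)
    (G : SimpleGraph (Fin k)) (w : Fin k → Fin k → ℝ)
    (hwsymm : ∀ p q, w p q = w q p) (hwpos : ∀ p q, G.Adj p q → 0 ≤ w p q)
    (hw0 : ∀ p q, ¬ G.Adj p q → w p q = 0)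
    (nn : Fin k → ℕ)
    (Ed : ∀ i : Fin k, Finset (Finset (Fin (nn i))))
    (hunif : ∀ i, ∀ e ∈ Ed i, e.card = m)
    (r : Fin k → ℕ)
    (hreg : ∀ i, ∀ v : Fin (nn i), ((Ed i).filter (fun e => v ∈ e)).card = r i)
    (p : Fin k) (l : ℕ) (lam : ℝ) (f : Fin l → (Fin (nn p) → ℝ))
    (hli : LinearIndependent ℝ f)
    (heig : ∀ j, Matrix.mulVec (adjW (Ed p) (fun _ => (1 : ℝ))) (f j) = lam • f j)
    (horth : ∀ j, ∑ v, f j v = 0)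
    (u v : Fin (nn p)) (huv : u ≠ v) :
    ∃ g : Fin l → (JV nn → ℝ),
      LinearIndependent ℝ g ∧
      ∀ j, Matrix.mulVec
          (adjW (gbEdges nn G Ed m) (gbWeight nn G Ed (fun _ _ => (1 : ℝ)) w)) (g j)
        = (lam - ∑ q ∈ Finset.univ.filter (fun q => G.Adj p q),
            w p q * ((((pairNewEdges nn m p q).filter (fun e =>
                (⟨p, u⟩ : JV nn) ∈ e ∧ (⟨p, v⟩ : JV nn) ∈ e)).card : ℝ)
              / ((m : ℝ) - 1))) • g j := by
  refine ⟨fun j => Function.extend (semb nn p) (f j) 0, ?_, fun j => ?_⟩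
  · refine LinearIndependent.of_comp (LinearMap.funLeft ℝ ℝ (semb nn p)) ?_
    convert hli using 1
    ext j x
    exact (semb nn p).injective.extend_apply (f j) 0 x
  · rw [← backboneAdj_eq_sum hwsymm m u v]
    exact mulVec_adjW_gbEdges_extend G Ed w m huv (heig j) (horth j)
end

section
/- Let m ≥ 2 and n_1,…,n_m ≥ 1 with n = Σ_{i=1}^m n_i. The characteristic polynomial of the adjacency matrix of the complete m-uniform m-partite hypergraph K^m_{n_1,n_2,…,n_m} is x^{n−m}·( x^m − Σ_{i=2}^m ((i−1)/(m−1)^i)·σ_i(s_1,s_2,…,s_m)·x^{m−i} ), where s_i = Π_{j=1, j≠i}^m n_j and σ_i(s_1,…,s_m) = Σ_{1≤j_1<j_2<…<j_i≤m} s_{j_1}s_{j_2}⋯s_{j_i} is the i-th elementary symmetric polynomial. In particular, the eigenvalue 0 has multiplicity exactly n − m. -/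
open scoped BigOperators
open Polynomial

/-- The edge set of the complete `m`-uniform `m`-partite hypergraph with parts
`V_p = {p} × Fin (nn p)`: all `m`-element subsets containing exactly one vertex
from each part. -/
def KEdges (m : ℕ) (nn : Fin m → ℕ) : Finset (Finset (Σ p : Fin m, Fin (nn p))) :=
  Finset.univ.filter
    (fun f => f.card = m ∧ ∀ p : Fin m, (f.filter (fun x => x.1 = p)).card = 1)

/-- The adjacency matrix: `A i j = d_{ij} / (m - 1)` for `i ≠ j`, where `d_{ij}`
is the number of edges containing both `i` and `j`, and `A i i = 0`. -/
noncomputable def KAdj (m : ℕ) (nn : Fin m → ℕ) :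
    Matrix (Σ p : Fin m, Fin (nn p)) (Σ p : Fin m, Fin (nn p)) ℝ :=
  fun i j => if i = j then 0 else
    (((KEdges m nn).filter (fun f => i ∈ f ∧ j ∈ f)).card : ℝ) / ((m : ℝ) - 1)

open Finset Matrix

/-- The matrix determinant lemma for a rank-one perturbation of a diagonal matrix. -/
theorem det_diagonal_sub_vecMulVec_one {R ι : Type*} [CommRing R] [IsDomain R] [Fintype ι]
    [DecidableEq ι] (d a : ι → R) (hd : ∀ i, d i ≠ 0) :
    (diagonal d - vecMulVec a 1).det = ∏ i, d i - ∑ i, a i * ∏ j ∈ univ.erase i, d j := by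
  let φ := algebraMap R (FractionRing R)
  have hφ : Function.Injective φ := IsFractionRing.injective R (FractionRing R)
  have hφd : ∀ i, φ (d i) ≠ 0 := fun i => (map_ne_zero_iff φ hφ).2 (hd i)
  apply hφ
  have hfac : φ.mapMatrix (diagonal d - vecMulVec a 1) =
      diagonal (fun i => φ (d i)) *
        (1 + replicateCol Unit (fun i => -(φ (a i) / φ (d i))) *
          replicateRow Unit (1 : ι → FractionRing R)) := by
    ext i j
    rw [diagonal_mul]
    by_cases hij : i = j
    · subst hij
      simp [Matrix.mul_apply, mul_add, mul_div_cancel₀, hφd i]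
      field_simp [hφd i]
      ring
    · simp [Matrix.mul_apply, hij]
      field_simp [hφd i]
  rw [RingHom.map_det, hfac, det_mul, det_diagonal, det_one_add_replicateCol_mul_replicateRow]
  simp only [map_sub, map_prod, map_sum, map_mul, dotProduct, Pi.one_apply, one_mul,
    Finset.sum_neg_distrib, ← sub_eq_add_neg]
  rw [mul_sub, mul_one, Finset.mul_sum]
  congr 1
  refine Finset.sum_congr rfl fun i _ => ?_
  rw [← Finset.mul_prod_erase univ (fun i => φ (d i)) (mem_univ i)]
  field_simp [hφd i]

/-- The characteristic polynomial of a matrix whose off-diagonal entries are constant on rows and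
whose diagonal vanishes. -/
theorem charpoly_offDiag_row_const {ι : Type*} [Fintype ι] [DecidableEq ι] (a : ι → ℝ) :
    (Matrix.of fun i j => if i = j then 0 else a i).charpoly =
      ∏ i, (X + C (a i)) - ∑ i, C (a i) * ∏ j ∈ univ.erase i, (X + C (a j)) := by
  rw [← det_diagonal_sub_vecMulVec_one _ _ fun i => X_add_C_ne_zero (a i), Matrix.charpoly]
  congr 1
  ext1 i j
  by_cases hij : i = j
  · subst hij
    simp
  · simp [hij]

theorem X_mul_derivative_prod_X_add_C {ι : Type*} [Fintype ι] [DecidableEq ι] (a : ι → ℝ) :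
    X * derivative (∏ i, (X + C (a i))) =
      (Fintype.card ι : ℝ[X]) * ∏ i, (X + C (a i)) -
        ∑ i, C (a i) * ∏ j ∈ univ.erase i, (X + C (a j)) := by
  rw [derivative_prod_finset, eq_sub_iff_add_eq, Finset.mul_sum, ← Finset.sum_add_distrib]
  have h : ∀ i ∈ (univ : Finset ι), X * ((∏ j ∈ univ.erase i, (X + C (a j))) *
      derivative (X + C (a i))) + C (a i) * ∏ j ∈ univ.erase i, (X + C (a j)) =
        ∏ j, (X + C (a j)) := fun i hi => by
    rw [← Finset.mul_prod_erase univ (fun i => X + C (a i)) hi]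
    simp only [derivative_add, derivative_X, derivative_C]
    ring
  rw [Finset.sum_congr rfl h]
  simp

theorem prod_X_add_C_eq_sum_powersetCard {ι : Type*} [Fintype ι] (a : ι → ℝ) :
    ∏ i, (X + C (a i)) = ∑ k ∈ range (Fintype.card ι + 1),
      C (∑ t ∈ (univ : Finset ι).powersetCard k, ∏ i ∈ t, a i) * X ^ (Fintype.card ι - k) := by
  have h := Multiset.prod_X_add_C_eq_sum_esymm ((univ : Finset ι).val.map a)
  simpa [Finset.esymm_map_val, Multiset.map_map] using h

theorem charpoly_offDiag_row_const_eq_sum (m : ℕ) (hm : 2 ≤ m) (a : Fin m → ℝ) :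
    (Matrix.of fun i j => if i = j then 0 else a i).charpoly =
      X ^ m - ∑ k ∈ Icc 2 m,
        C (((k : ℝ) - 1) * ∑ t ∈ (univ : Finset (Fin m)).powersetCard k, ∏ i ∈ t, a i) *
          X ^ (m - k) := by
  have hder := X_mul_derivative_prod_X_add_C a
  have hsum := prod_X_add_C_eq_sum_powersetCard a
  rw [Fintype.card_fin] at hder hsum
  set e : ℕ → ℝ := fun k => ∑ t ∈ (univ : Finset (Fin m)).powersetCard k, ∏ i ∈ t, a i with he
  change _ = ∑ k ∈ range (m + 1), C (e k) * X ^ (m - k) at hsum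
  change _ = X ^ m - ∑ k ∈ Icc 2 m, C (((k : ℝ) - 1) * e k) * X ^ (m - k)
  have he0 : e 0 = 1 := by simp [he]
  have hmain : (Matrix.of fun i j => if i = j then 0 else a i).charpoly =
      ∑ k ∈ range (m + 1), C ((1 - (k : ℝ)) * e k) * X ^ (m - k) := by
    have h1 : (Matrix.of fun i j => if i = j then 0 else a i).charpoly =
        (1 - (m : ℝ[X])) * ∏ i, (X + C (a i)) + X * derivative (∏ i, (X + C (a i))) := by
      rw [charpoly_offDiag_row_const, hder]
      ring
    rw [h1, hsum, derivative_sum, Finset.mul_sum, Finset.mul_sum, ← Finset.sum_add_distrib]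
    refine Finset.sum_congr rfl fun k hk => ?_
    obtain ⟨d, rfl⟩ := Nat.exists_eq_add_of_le (Nat.lt_succ_iff.1 (mem_range.1 hk))
    rw [Nat.add_sub_cancel_left, derivative_C_mul_X_pow]
    cases d with
    | zero => simp
    | succ d =>
      simp only [Nat.add_sub_cancel, Nat.cast_add, Nat.cast_one, C_mul, C_sub, C_add, C_1,
        map_natCast]
      ring
  have hr : range (m + 1) = insert 0 (insert 1 (Icc 2 m)) := by
    ext k; simp; omega
  rw [hmain, hr, sum_insert (by simp), sum_insert (by simp)]
  have hneg : ∀ k ∈ Icc 2 m, C ((1 - (k : ℝ)) * e k) * X ^ (m - k) =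
      -(C (((k : ℝ) - 1) * e k) * X ^ (m - k)) := fun k _ => by
    rw [← neg_mul, ← C_neg, ← neg_mul, neg_sub]
  rw [Finset.sum_congr rfl hneg, Finset.sum_neg_distrib]
  simp [he0, sub_eq_add_neg]

/-- The number of edges through two vertices in different parts. -/
theorem card_KEdges_filter {m : ℕ} {nn : Fin m → ℕ} {i j : Σ p : Fin m, Fin (nn p)}
    (hij : i.1 ≠ j.1) :
    ((KEdges m nn).filter (fun f => i ∈ f ∧ j ∈ f)).card =
      ∏ l ∈ (univ.erase i.1).erase j.1, nn l := by
  let T : ∀ l : Fin m, Finset (Fin (nn l)) := fun l =>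
    univ.filter fun x => (l = i.1 → (⟨l, x⟩ : Σ p, Fin (nn p)) = i) ∧
      (l = j.1 → (⟨l, x⟩ : Σ p, Fin (nn p)) = j)
  have hT : (Fintype.piFinset T).card = ∏ l ∈ (univ.erase i.1).erase j.1, nn l := by
    rw [Fintype.card_piFinset, ← Finset.mul_prod_erase univ _ (mem_univ i.1),
      ← Finset.mul_prod_erase (univ.erase i.1) _ (mem_erase.2 ⟨hij.symm, mem_univ j.1⟩)]
    have hi : (T i.1).card = 1 := by
      rw [card_eq_one]
      refine ⟨i.2, ?_⟩
      ext x
      simp [T, hij, Sigma.ext_iff]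
    have hj : (T j.1).card = 1 := by
      rw [card_eq_one]
      refine ⟨j.2, ?_⟩
      ext x
      simp [T, hij.symm, Sigma.ext_iff]
    rw [hi, hj, one_mul, one_mul]
    refine Finset.prod_congr rfl fun l hl => ?_
    simp only [mem_erase, mem_univ, and_true] at hl
    simp [T, hl.1, hl.2]
  rw [← hT]
  symm
  refine Finset.card_bij (fun g _ => univ.sigma fun p => {g p}) ?_ ?_ ?_
  · intro g hg
    simp only [Fintype.mem_piFinset, T, mem_filter, mem_univ, true_and] at hg
    simp only [KEdges, mem_filter, mem_univ, true_and, mem_sigma, mem_singleton, card_sigma,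
      card_singleton]
    refine ⟨⟨by simp, fun p => ?_⟩, ?_, ?_⟩
    · rw [card_eq_one]
      refine ⟨⟨p, g p⟩, ?_⟩
      ext ⟨q, x⟩
      simp only [mem_filter, mem_sigma, mem_univ, mem_singleton, true_and]
      constructor
      · rintro ⟨rfl, rfl⟩; rfl
      · intro h; cases h; exact ⟨rfl, rfl⟩
    · have := (hg i.1).1 rfl
      rw [← this]
    · have := (hg j.1).2 rfl
      rw [← this]
  · intro g _ g' _ h
    funext p
    have : (⟨p, g p⟩ : Σ p, Fin (nn p)) ∈ univ.sigma fun p => ({g' p} : Finset _) := by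
      rw [← h]; simp
    simpa using this
  · intro f hf
    simp only [KEdges, mem_filter, mem_univ, true_and] at hf
    obtain ⟨⟨-, hp⟩, hif, hjf⟩ := hf
    have hex : ∀ p, ∃ x : Fin (nn p), f.filter (fun y => y.1 = p) = {⟨p, x⟩} := fun p => by
      obtain ⟨⟨q, x⟩, hy⟩ := card_eq_one.1 (hp p)
      have hmem : (⟨q, x⟩ : Σ p, Fin (nn p)) ∈ f.filter (fun y => y.1 = p) := by
        rw [hy]
        exact mem_singleton_self _
      have hq : q = p := (mem_filter.1 hmem).2
      subst hq
      exact ⟨x, hy⟩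
    choose g hg using hex
    have hmem : ∀ y, y ∈ f ↔ y = ⟨y.1, g y.1⟩ := fun y => by
      rw [← mem_singleton, ← hg y.1]
      simp
    refine ⟨g, ?_, ?_⟩
    · simp only [Fintype.mem_piFinset, T, mem_filter, mem_univ, true_and]
      refine fun l => ⟨?_, ?_⟩
      · rintro rfl; exact ((hmem i).1 hif).symm
      · rintro rfl; exact ((hmem j).1 hjf).symm
    · ext ⟨q, x⟩
      rw [hmem]
      simp

theorem KEdges_filter_eq_empty {m : ℕ} {nn : Fin m → ℕ} {i j : Σ p : Fin m, Fin (nn p)}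
    (hne : i ≠ j) (hij : i.1 = j.1) :
    (KEdges m nn).filter (fun f => i ∈ f ∧ j ∈ f) = ∅ := by
  rw [Finset.filter_eq_empty_iff]
  rintro f hf ⟨hif, hjf⟩
  simp only [KEdges, mem_filter, mem_univ, true_and] at hf
  exact hne (card_le_one.1 (hf.2 j.1).le i (mem_filter.2 ⟨hif, hij⟩) j (mem_filter.2 ⟨hjf, rfl⟩))

theorem KAdj_apply {m : ℕ} {nn : Fin m → ℕ} (i j : Σ p : Fin m, Fin (nn p)) :
    KAdj m nn i j = if i.1 = j.1 then 0 else
      (∏ l ∈ (univ.erase i.1).erase j.1, (nn l : ℝ)) / ((m : ℝ) - 1) := by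
  unfold KAdj
  split_ifs with h h' h'
  · rfl
  · exact absurd (congrArg Sigma.fst h) h'
  · rw [KEdges_filter_eq_empty h h']
    simp
  · rw [card_KEdges_filter h']
    push_cast
    rfl

/-- Passing to the quotient matrix of the partition into the parts. -/
theorem KAdj_charpoly (m : ℕ) (nn : Fin m → ℕ) (hnn : ∀ i, 1 ≤ nn i) :
    (KAdj m nn).charpoly = X ^ ((∑ i, nn i) - m) *
      (Matrix.of fun p q : Fin m => if p = q then 0 else
        (∏ l ∈ univ.erase p, (nn l : ℝ)) / ((m : ℝ) - 1)).charpoly := by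
  let U : Matrix (Σ p : Fin m, Fin (nn p)) (Fin m) ℝ := Matrix.of fun i p => if i.1 = p then 1 else 0
  let Q : Matrix (Fin m) (Σ p : Fin m, Fin (nn p)) ℝ := Matrix.of fun p j =>
    if p = j.1 then 0 else (∏ l ∈ (univ.erase p).erase j.1, (nn l : ℝ)) / ((m : ℝ) - 1)
  have hUQ : KAdj m nn = U * Q := by
    ext i j
    rw [KAdj_apply, Matrix.mul_apply, Finset.sum_eq_single i.1]
    · simp [U, Q]
    · intro p _ hp
      simp [U, hp.symm]
    · simp
  have hQU : Q * U = Matrix.of fun p q : Fin m => if p = q then 0 else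
      (∏ l ∈ univ.erase p, (nn l : ℝ)) / ((m : ℝ) - 1) := by
    ext p q
    simp only [Matrix.mul_apply, U, Q, Matrix.of_apply, Fintype.sum_sigma, mul_ite, mul_one,
      mul_zero, sum_const, card_univ, Fintype.card_fin, nsmul_eq_mul, Finset.sum_ite_eq', mem_univ,
      if_true]
    split_ifs with h
    · simp
    · rw [← Finset.mul_prod_erase (univ.erase p) _ (mem_erase.2 ⟨Ne.symm h, mem_univ q⟩),
        mul_div_assoc]
  have hcard : Fintype.card (Σ p : Fin m, Fin (nn p)) = ∑ i, nn i := by simp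
  have hle : Fintype.card (Fin m) ≤ Fintype.card (Σ p : Fin m, Fin (nn p)) := by
    rw [hcard]
    simpa using Finset.sum_le_sum fun i (_ : i ∈ univ) => hnn i
  rw [hUQ, charpoly_mul_comm_of_le U Q hle, hQU, hcard, Fintype.card_fin]

/-- the characteristic polynomial of `K^m_{n_1,…,n_m}` is
`x^(n-m) (x^m - ∑_{i=2}^m ((i-1)/(m-1)^i) σ_i(s_1,…,s_m) x^(m-i))`, where
`s_i = ∏_{j ≠ i} n_j` and `σ_i` is the `i`-th elementary symmetric polynomial;
moreover `0` is a root of multiplicity exactly `n - m`. -/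
theorem stmt_4 (m : ℕ) (hm : 2 ≤ m) (nn : Fin m → ℕ) (hnn : ∀ i, 1 ≤ nn i) :
    (KAdj m nn).charpoly
        = X ^ ((∑ i, nn i) - m) *
          (X ^ m - ∑ i ∈ Finset.Icc 2 m,
            C (((i : ℝ) - 1) / ((m : ℝ) - 1) ^ i *
                (∑ t ∈ (Finset.univ : Finset (Fin m)).powersetCard i,
                  ∏ j ∈ t, ∏ l ∈ Finset.univ.erase j, (nn l : ℝ))) *
              X ^ (m - i))
      ∧ (KAdj m nn).charpoly.rootMultiplicity 0 = (∑ i, nn i) - m := by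
  have hm1 : (m : ℝ) - 1 ≠ 0 := by
    have : (2 : ℝ) ≤ m := by exact_mod_cast hm
    linarith
  have hchar := KAdj_charpoly m nn hnn
  rw [charpoly_offDiag_row_const_eq_sum m hm] at hchar
  have hcoeff : ∀ i : ℕ, ((i : ℝ) - 1) * ∑ t ∈ (univ : Finset (Fin m)).powersetCard i,
      ∏ j ∈ t, ((∏ l ∈ univ.erase j, (nn l : ℝ)) / ((m : ℝ) - 1)) =
      ((i : ℝ) - 1) / ((m : ℝ) - 1) ^ i * ∑ t ∈ (univ : Finset (Fin m)).powersetCard i,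
        ∏ j ∈ t, ∏ l ∈ univ.erase j, (nn l : ℝ) := fun i => by
    rw [div_mul_eq_mul_div, mul_div_assoc, Finset.sum_div]
    congr 1
    refine Finset.sum_congr rfl fun t ht => ?_
    rw [Finset.prod_div_distrib, Finset.prod_const, (mem_powersetCard.1 ht).2]
  simp only [hcoeff] at hchar
  refine ⟨hchar, ?_⟩
  have hne := (KAdj m nn).charpoly_monic.ne_zero
  rw [hchar] at hne ⊢
  rw [rootMultiplicity_mul hne, rootMultiplicity_eq_natTrailingDegree', natTrailingDegree_X_pow,
    rootMultiplicity_eq_zero, add_zero]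
  have hpos : (0 : ℝ) < ∏ j : Fin m, ∏ l ∈ univ.erase j, (nn l : ℝ) :=
    Finset.prod_pos fun j _ => Finset.prod_pos fun l _ => by exact_mod_cast hnn l
  have hself : (univ : Finset (Fin m)).powersetCard m = {univ} := by
    simpa using powersetCard_self (univ : Finset (Fin m))
  rw [IsRoot.def, eval_sub, eval_finsetSum, Finset.sum_eq_single_of_mem m (mem_Icc.2 ⟨hm, le_rfl⟩)]
  · simp only [eval_pow, eval_X, eval_C, Nat.sub_self, pow_zero, mul_one, hself,
      sum_singleton, zero_pow (by omega : m ≠ 0), zero_sub]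
    exact neg_ne_zero.2 (mul_ne_zero (div_ne_zero hm1 (pow_ne_zero _ hm1)) hpos.ne')
  · intro k hk hkm
    have : m - k ≠ 0 := by
      have := mem_Icc.1 hk
      omega
    simp [this]
end

section
/- Let H_0 be an m-uniform hypergraph on n = pk vertices whose vertex set is partitioned into k blocks of size p, and let H_1,…,H_k be r_1-regular m-uniform hypergraphs, each on n_1 vertices. Let H_π = H_0 ∘^k_p H_i be the generalized vertex corona, and set a = (p/(m−1))·[C(n+n_1−2, m−2) − C(n, m−2)], b = C(n+n_1−2, m−1), c = (1/(m−1))·[C(n+n_1−2, m−2) − C(n_1−2, m−2)], D_i = A_{H_i} + c(J_{n_1} − I_{n_1}), D = diag(I_p⊗D_1, I_p⊗D_2,…, I_p⊗D_k), and S = I_k ⊗ J_{p×pn_1}, so that the adjacency matrix of H_π is the block matrix A_{H_π} = [[A_{H_0} + a·I_k⊗(J_p − I_p), bS],[bS^T, D]]. Then the characteristic polynomial of A_{H_π} is f(x) = ( Π_{i=1}^k det(D_i − xI_{n_1}) )^p · det( A_{H_0} + I_k ⊗ ( (a − b^2 p n_1/(r_1+(n_1−1)c−x))·J_p − (a+x)·I_p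 ) ). -/
open scoped BigOperators
open Matrix

/-- Adjacency matrix of an (unweighted) `m`-uniform hypergraph with edge set `E`:
`A i j = d_{ij}/(m-1)` for `i ≠ j` (`d_{ij}` = number of edges containing both),
`A i i = 0`. -/
noncomputable def adjU {V : Type*} [DecidableEq V]
    (E : Finset (Finset V)) (m : ℕ) : Matrix V V ℝ :=
  fun i j => if i = j then 0 else
    ((E.filter (fun e => i ∈ e ∧ j ∈ e)).card : ℝ) / ((m : ℝ) - 1)

/-- If the columns of `C` lie in the range of `Q`, say `Q * Y = C`, then the Schur complement
formula holds even when `Q` is singular. -/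
theorem det_fromBlocks_of_mul_eq {R α β : Type*} [CommRing R] [Fintype α] [DecidableEq α]
    [Fintype β] [DecidableEq β] (A : Matrix α α R) (B : Matrix α β R) (C : Matrix β α R)
    (Q : Matrix β β R) (Y : Matrix β α R) (h : Q * Y = C) :
    (Matrix.fromBlocks A B C Q).det = (A - B * Y).det * Q.det := by
  have key : Matrix.fromBlocks A B C Q
      = Matrix.fromBlocks (A - B * Y) B 0 Q * Matrix.fromBlocks 1 0 Y 1 := by
    simp [Matrix.fromBlocks_multiply, h]
  rw [key, Matrix.det_mul, Matrix.det_fromBlocks_zero₂₁, Matrix.det_fromBlocks_zero₁₂]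
  simp

/-- The adjacency matrix of an `r`-regular `m`-uniform hypergraph has all row sums equal to `r`. -/
theorem sum_adjU_of_regular {V : Type*} [Fintype V] [DecidableEq V] (E : Finset (Finset V))
    {m r : ℕ} (hm : 2 ≤ m) (hE : ∀ e ∈ E, e.card = m) {v : V}
    (hr : (E.filter (fun e => v ∈ e)).card = r) : ∑ w, adjU E m v w = r := by
  have hm1 : (m : ℝ) - 1 ≠ 0 := by
    have : (2 : ℝ) ≤ m := by exact_mod_cast hm
    linarith
  have count : ∑ w ∈ Finset.univ.erase v, (E.filter (fun e => v ∈ e ∧ w ∈ e)).card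
      = r * (m - 1) := by
    have hcomm := Finset.sum_card_bipartiteAbove_eq_sum_card_bipartiteBelow
      (s := Finset.univ.erase v) (t := E.filter (fun e => v ∈ e)) (fun w e => w ∈ e)
    simp only [Finset.bipartiteAbove, Finset.bipartiteBelow, Finset.filter_filter] at hcomm
    rw [hcomm, ← hr, ← smul_eq_mul, ← Finset.sum_const]
    refine Finset.sum_congr rfl fun e he => ?_
    obtain ⟨heE, hve⟩ := Finset.mem_filter.1 he
    rw [← hE e heE, ← Finset.card_erase_of_mem hve]
    congr 1
    ext w
    simp
  have hsum : ∑ w, adjU E m v w = ∑ w ∈ Finset.univ.erase v,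
      ((E.filter (fun e => v ∈ e ∧ w ∈ e)).card : ℝ) / ((m : ℝ) - 1) := by
    rw [← Finset.add_sum_erase _ _ (Finset.mem_univ v)]
    simp only [adjU, if_true, zero_add]
    exact Finset.sum_congr rfl fun w hw => if_neg (Finset.ne_of_mem_erase hw).symm
  rw [hsum, ← Finset.sum_div, ← Nat.cast_sum, count, Nat.cast_mul, Nat.cast_sub (by omega),
    Nat.cast_one, mul_div_cancel_right₀ _ hm1]

/-- The determinant of a block diagonal matrix in which the block `M i` is repeated `p` times. -/
theorem det_repeated_blocks {R : Type*} [CommRing R] {k p n : ℕ}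
    (M : Fin k → Matrix (Fin n) (Fin n) R) :
    (Matrix.of (fun x y : Fin k × Fin p × Fin n =>
      if x.1 = y.1 ∧ x.2.1 = y.2.1 then M x.1 x.2.2 y.2.2 else 0)).det
      = (∏ i, (M i).det) ^ p := by
  let e : Fin k × Fin p × Fin n ≃ Fin n × (Fin k × Fin p) :=
    (Equiv.prodAssoc _ _ _).symm.trans (Equiv.prodComm _ _)
  have h : Matrix.of (fun x y : Fin k × Fin p × Fin n =>
      if x.1 = y.1 ∧ x.2.1 = y.2.1 then M x.1 x.2.2 y.2.2 else 0)
      = (Matrix.blockDiagonal (fun o : Fin k × Fin p => M o.1)).submatrix e e := by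
    ext ⟨i, j, v⟩ ⟨i', j', v'⟩
    simp [e, Matrix.blockDiagonal_apply]
  rw [h, Matrix.det_submatrix_equiv_self, Matrix.det_blockDiagonal, Fintype.prod_prod_type]
  simp [Finset.prod_pow]

/-- characteristic polynomial (in the form `det(A - xI)`) of the
generalized vertex corona `H_π = H_0 ∘^k_p H_i`.  The vertices of `H_0` are indexed by
`Fin k × Fin p` (the `k` blocks of size `p`), the attached copies by
`Fin k × Fin p × Fin n₁`.  With `n = pk`,
`a = (p/(m-1))(C(n+n₁-2, m-2) - C(n, m-2))`, `b = C(n+n₁-2, m-1)`,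
`c = (1/(m-1))(C(n+n₁-2, m-2) - C(n₁-2, m-2))`, `D_i = A_{H_i} + c(J-I)`,
the adjacency matrix of `H_π` is the block matrix
`[[A_{H_0} + a·I_k⊗(J_p - I_p), b·S], [b·Sᵀ, D]]` with `S = I_k ⊗ J_{p×pn₁}` and
`D = diag(I_p⊗D_1, …, I_p⊗D_k)`, and for every `x` with `r₁+(n₁-1)c-x ≠ 0`,
`det(A_{H_π} - xI) = (∏ᵢ det(Dᵢ - xI))^p ·
det(A_{H_0} + I_k⊗((a - b²pn₁/(r₁+(n₁-1)c-x))J_p - (a+x)I_p))`. -/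
theorem stmt_8 (k p n₁ m r₁ : ℕ) (hm : 2 ≤ m) (hk : 1 ≤ k) (hp : 1 ≤ p) (hn₁ : 1 ≤ n₁)
    (E₀ : Finset (Finset (Fin k × Fin p)))
    (hE₀ : ∀ e ∈ E₀, e.card = m)
    (Ed : Fin k → Finset (Finset (Fin n₁)))
    (hEd : ∀ i, ∀ e ∈ Ed i, e.card = m)
    (hreg : ∀ i, ∀ v : Fin n₁, ((Ed i).filter (fun e => v ∈ e)).card = r₁)
    (a b c : ℝ)
    (ha : a = ((p : ℝ) / ((m : ℝ) - 1)) *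
      ((Nat.choose (p * k + n₁ - 2) (m - 2) : ℝ) - (Nat.choose (p * k) (m - 2) : ℝ)))
    (hb : b = (Nat.choose (p * k + n₁ - 2) (m - 1) : ℝ))
    (hc : c = (1 / ((m : ℝ) - 1)) *
      ((Nat.choose (p * k + n₁ - 2) (m - 2) : ℝ) - (Nat.choose (n₁ - 2) (m - 2) : ℝ)))
    (D : Fin k → Matrix (Fin n₁) (Fin n₁) ℝ)
    (hD : ∀ i, D i = adjU (Ed i) m + c • (Matrix.of (fun _ _ => (1 : ℝ)) - 1))
    (Aπ : Matrix ((Fin k × Fin p) ⊕ (Fin k × Fin p × Fin n₁))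
      ((Fin k × Fin p) ⊕ (Fin k × Fin p × Fin n₁)) ℝ)
    (hAπ : Aπ = Matrix.fromBlocks
      (adjU E₀ m + a • Matrix.of (fun i j : Fin k × Fin p =>
        if i.1 = j.1 ∧ i.2 ≠ j.2 then (1 : ℝ) else 0))
      (b • Matrix.of (fun i : Fin k × Fin p => fun j : Fin k × Fin p × Fin n₁ =>
        if i.1 = j.1 then (1 : ℝ) else 0))
      (b • Matrix.of (fun j : Fin k × Fin p × Fin n₁ => fun i : Fin k × Fin p =>
        if i.1 = j.1 then (1 : ℝ) else 0))
      (Matrix.of (fun x y : Fin k × Fin p × Fin n₁ =>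
        if x.1 = y.1 ∧ x.2.1 = y.2.1 then D x.1 x.2.2 y.2.2 else 0))) :
    ∀ x : ℝ, (r₁ : ℝ) + ((n₁ : ℝ) - 1) * c - x ≠ 0 →
      (Aπ - x • 1).det
        = (∏ i : Fin k, (D i - x • 1).det) ^ p *
          (adjU E₀ m + Matrix.of (fun i j : Fin k × Fin p =>
            if i.1 = j.1 then
              (a - b ^ 2 * (p : ℝ) * (n₁ : ℝ) / ((r₁ : ℝ) + ((n₁ : ℝ) - 1) * c - x))
                - (if i = j then a + x else 0)
            else 0)).det := by
  intro x hx
  have hrow : ∀ i v, ∑ w, (D i - x • 1) v w = (r₁ : ℝ) + ((n₁ : ℝ) - 1) * c - x := by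
    intro i v
    simp only [hD, Matrix.sub_apply, Matrix.add_apply, Matrix.smul_apply, Matrix.of_apply,
      Matrix.one_apply, smul_eq_mul, Finset.sum_sub_distrib, Finset.sum_add_distrib,
      ← Finset.mul_sum, sum_adjU_of_regular (Ed i) hm (hEd i) (hreg i v)]
    simp
    ring
  set μ : ℝ := (r₁ : ℝ) + ((n₁ : ℝ) - 1) * c - x with hμ
  set Q : Matrix (Fin k × Fin p × Fin n₁) (Fin k × Fin p × Fin n₁) ℝ :=
    Matrix.of (fun s t => if s.1 = t.1 ∧ s.2.1 = t.2.1 then (D s.1 - x • 1) s.2.2 t.2.2 else 0)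
    with hQ
  set Y : Matrix (Fin k × Fin p × Fin n₁) (Fin k × Fin p) ℝ :=
    Matrix.of (fun t i => if t.1 = i.1 then b / μ else 0) with hY
  have hQY : Q * Y = b • Matrix.of (fun j : Fin k × Fin p × Fin n₁ => fun i : Fin k × Fin p =>
      if i.1 = j.1 then (1 : ℝ) else 0) := by
    ext ⟨i, j, v⟩ ⟨i', j'⟩
    simp only [hQ, hY, Matrix.mul_apply, Matrix.of_apply, Fintype.sum_prod_type, ite_and,
      ite_mul, zero_mul, Finset.sum_ite_irrel, Finset.sum_const_zero, Finset.sum_ite_eq,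
      Finset.mem_univ, if_true, Matrix.smul_apply b, smul_eq_mul]
    by_cases h : i = i'
    · subst h
      simp only [if_true, ← Finset.sum_mul, hrow]
      rw [mul_div_cancel₀ _ hx, mul_one]
    · simp [h, Ne.symm h]
  have hblocks : Aπ - x • 1 = Matrix.fromBlocks
      (adjU E₀ m + a • Matrix.of (fun i j : Fin k × Fin p =>
        if i.1 = j.1 ∧ i.2 ≠ j.2 then (1 : ℝ) else 0) - x • 1)
      (b • Matrix.of (fun i : Fin k × Fin p => fun j : Fin k × Fin p × Fin n₁ =>
        if i.1 = j.1 then (1 : ℝ) else 0))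
      (b • Matrix.of (fun j : Fin k × Fin p × Fin n₁ => fun i : Fin k × Fin p =>
        if i.1 = j.1 then (1 : ℝ) else 0)) Q := by
    rw [hAπ, ← Matrix.fromBlocks_one, Matrix.fromBlocks_smul, sub_eq_add_neg,
      Matrix.fromBlocks_neg, Matrix.fromBlocks_add]
    simp only [smul_zero, neg_zero, add_zero, ← sub_eq_add_neg]
    congr 1
    ext ⟨i, j, v⟩ ⟨i', j', v'⟩
    by_cases h : i = i' <;> by_cases h' : j = j' <;> simp [hQ, h, h', Matrix.one_apply]
  rw [hblocks, det_fromBlocks_of_mul_eq _ _ _ _ Y hQY, hQ,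
    det_repeated_blocks (fun i => D i - x • 1), mul_comm]
  congr 2
  ext ⟨i, j⟩ ⟨i', j'⟩
  by_cases h : i = i' <;> by_cases h' : j = j' <;>
    simp [hY, Matrix.mul_apply, Fintype.sum_prod_type, h, h'] <;> ring
end

section
/- Let H(V,E) be an m-uniform hypergraph with adjacency matrix A, and let ρ = {V_1,…,V_k, D} be a partition of V with |D| = m−1 and |V_i| = 2t for all i, such that: (1) for all p,q ∈ {1,…,k}, the sum Σ_{l∈V_q} A_{il} takes a common value B′_{pq} for all i ∈ V_p, and B′_{pq} = B′_{qp}; (2) every edge e ∈ E satisfies |e ∩ D| = 0 or m−1, and, writing N(D) = {v ∈ V : D ∪ {v} ∈ E}, for each p the set N(D) ∩ V_p has size 0, t, or 2t. Let H_ρ be the hypergraph obtained from H by replacing, for every p with |N(D) ∩ V_p| = t, the edges D ∪ {v} for v ∈ N(D) ∩ V_p by the edges D ∪ {v} for v ∈ V_p \ N(D). Then H and H_ρ are cospectral: their adjacency matrices have the same characteristic polynomial. -/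
open scoped BigOperators Classical

/-- The Godsil–McKay matrix of the parts `U p`: the identity on `D`, and `c J - 1` on each part. -/
noncomputable def gmMatrix {V ι : Type*} [DecidableEq V]
    (D : Finset V) (U : ι → Finset V) (c : ℝ) : Matrix V V ℝ :=
  fun i j => (if i = j then (if j ∈ D then 1 else -1) else 0) +
    (if ∃ p, i ∈ U p ∧ j ∈ U p then c else 0)

section gmMatrix

variable {V ι : Type*} [DecidableEq V] {D : Finset V} {U : ι → Finset V} {c : ℝ}

lemma gmMatrix_comm (i j : V) : gmMatrix D U c i j = gmMatrix D U c j i := by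
  unfold gmMatrix
  by_cases h : i = j
  · subst h; rfl
  · simp [h, Ne.symm h, and_comm]

lemma gmMatrix_apply_of_mem (hUD : ∀ p, Disjoint (U p) D) (i : V) {j : V} (hj : j ∈ D) :
    gmMatrix D U c i j = if i = j then 1 else 0 := by
  have h : ¬ ∃ p, i ∈ U p ∧ j ∈ U p := fun ⟨p, _, hp⟩ =>
    Finset.disjoint_left.1 (hUD p) hp hj
  simp [gmMatrix, h, hj]

lemma gmMatrix_apply_of_mem_part (hU : ∀ p q, p ≠ q → Disjoint (U p) (U q))
    (hUD : ∀ p, Disjoint (U p) D) (i : V) {j : V} {p : ι} (hj : j ∈ U p) :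
    gmMatrix D U c i j = (if i = j then -1 else 0) + (if i ∈ U p then c else 0) := by
  have h : (∃ q, i ∈ U q ∧ j ∈ U q) ↔ i ∈ U p := by
    refine ⟨fun ⟨q, hi, hq⟩ => ?_, fun hi => ⟨p, hi, hj⟩⟩
    by_contra hne
    have hqp : q ≠ p := fun h => hne (h ▸ hi)
    exact Finset.disjoint_left.1 (hU q p hqp) hq hj
  have hjD : j ∉ D := Finset.disjoint_left.1 (hUD p) hj
  simp [gmMatrix, h, hjD]

variable [Fintype V]

lemma mul_gmMatrix_apply_of_mem (hUD : ∀ p, Disjoint (U p) D) (M : Matrix V V ℝ) (i : V)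
    {j : V} (hj : j ∈ D) : (M * gmMatrix D U c) i j = M i j := by
  simp [Matrix.mul_apply, gmMatrix_apply_of_mem hUD _ hj]

lemma mul_gmMatrix_apply_of_mem_part (hU : ∀ p q, p ≠ q → Disjoint (U p) (U q))
    (hUD : ∀ p, Disjoint (U p) D) (M : Matrix V V ℝ) (i : V) {j : V} {p : ι} (hj : j ∈ U p) :
    (M * gmMatrix D U c) i j = c * ∑ l ∈ U p, M i l - M i j := by
  simp only [Matrix.mul_apply, gmMatrix_apply_of_mem_part hU hUD _ hj, mul_add,
    Finset.sum_add_distrib]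
  simp [Finset.mul_sum, mul_comm]
  ring

lemma gmMatrix_mul_apply (M : Matrix V V ℝ) (i j : V) :
    (gmMatrix D U c * M) i j = (M.transpose * gmMatrix D U c) j i := by
  simp only [Matrix.mul_apply, Matrix.transpose_apply]
  exact Finset.sum_congr rfl fun l _ => by rw [gmMatrix_comm, mul_comm]

lemma gmMatrix_mul_self (hU : ∀ p q, p ≠ q → Disjoint (U p) (U q))
    (hUD : ∀ p, Disjoint (U p) D) (hcover : ∀ i, i ∈ D ∨ ∃ p, i ∈ U p)
    (hc : ∀ p, c * (U p).card = 2) : gmMatrix D U c * gmMatrix D U c = 1 := by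
  ext i j
  rcases hcover j with hj | ⟨p, hj⟩
  · rw [mul_gmMatrix_apply_of_mem hUD _ _ hj, gmMatrix_apply_of_mem hUD _ hj, Matrix.one_apply]
  · rw [mul_gmMatrix_apply_of_mem_part hU hUD _ _ hj, gmMatrix_apply_of_mem_part hU hUD _ hj,
      Finset.sum_congr rfl fun l hl => gmMatrix_apply_of_mem_part hU hUD i hl,
      Finset.sum_add_distrib, Matrix.one_apply]
    by_cases hi : i ∈ U p
    · have := hc p
      simp only [Finset.sum_ite_eq, hi, if_true, Finset.sum_const, nsmul_eq_mul]
      split_ifs <;> linear_combination c * this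
    · have hij : i ≠ j := fun h => hi (h ▸ hj)
      simp [hi, hij]

/-- Godsil–McKay switching for symmetric real matrices. -/
lemma charpoly_eq_of_gm_switching {A B : Matrix V V ℝ}
    (hU : ∀ p q, p ≠ q → Disjoint (U p) (U q))
    (hUD : ∀ p, Disjoint (U p) D) (hcover : ∀ i, i ∈ D ∨ ∃ p, i ∈ U p)
    (hc : ∀ p, c * (U p).card = 2) (hA : ∀ i j, A i j = A j i) (hB : ∀ i j, B i j = B j i)
    (b : ι → ι → ℝ) (hrow : ∀ p q, ∀ i ∈ U p, ∑ l ∈ U q, A i l = b p q)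
    (hb : ∀ p q, b p q = b q p)
    (hDD : ∀ i ∈ D, ∀ j ∈ D, B i j = A i j) (hVV : ∀ i ∉ D, ∀ j ∉ D, B i j = A i j)
    (hDV : ∀ i ∈ D, ∀ p, ∀ j ∈ U p, B i j = c * ∑ l ∈ U p, A i l - A i j) :
    A.charpoly = B.charpoly := by
  have hQ := gmMatrix_mul_self hU hUD hcover hc
  have hnot : ∀ {p i}, i ∈ U p → i ∉ D := fun {p _} hi => Finset.disjoint_left.1 (hUD p) hi
  have hsum : ∀ i ∈ D, ∀ p, ∑ l ∈ U p, B i l = ∑ l ∈ U p, A i l := by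
    intro i hi p
    rw [Finset.sum_congr rfl (hDV i hi p), Finset.sum_sub_distrib, Finset.sum_const,
      nsmul_eq_mul]
    linear_combination (∑ l ∈ U p, A i l) * hc p
  have hBT : B.transpose = B := Matrix.ext fun i j => hB j i
  have hcomm : A * gmMatrix D U c = gmMatrix D U c * B := by
    ext i j
    rw [gmMatrix_mul_apply, hBT]
    rcases hcover i with hi | ⟨p, hi⟩ <;> rcases hcover j with hj | ⟨q, hj⟩
    · rw [mul_gmMatrix_apply_of_mem hUD _ _ hj, mul_gmMatrix_apply_of_mem hUD _ _ hi,
        hDD j hj i hi, hA]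
    · rw [mul_gmMatrix_apply_of_mem_part hU hUD _ _ hj, mul_gmMatrix_apply_of_mem hUD _ _ hi,
        hB j i, hDV i hi q j hj]
    · rw [mul_gmMatrix_apply_of_mem hUD _ _ hj, mul_gmMatrix_apply_of_mem_part hU hUD _ _ hi,
        hsum j hj, hDV j hj p i hi, hA i j]
      ring
    · rw [mul_gmMatrix_apply_of_mem_part hU hUD _ _ hj,
        mul_gmMatrix_apply_of_mem_part hU hUD _ _ hi,
        Finset.sum_congr rfl fun l hl => hVV j (hnot hj) l (hnot hl),
        hVV j (hnot hj) i (hnot hi), hrow p q i hi, hrow q p j hj, hb p q, hA i j]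
  have hAB : A = gmMatrix D U c * B * gmMatrix D U c := by
    rw [← hcomm, Matrix.mul_assoc, hQ, Matrix.mul_one]
  rw [hAB, Matrix.charpoly_mul_comm, ← Matrix.mul_assoc, hQ, Matrix.one_mul]

end gmMatrix

section Pendant

variable {V : Type*} [DecidableEq V]

lemma adjU_comm (E : Finset (Finset V)) (m : ℕ) (i j : V) : adjU E m i j = adjU E m j i := by
  simp only [adjU, eq_comm (a := i), and_comm (a := i ∈ _)]

lemma insert_injOn_of_disjoint {N D : Finset V} (hN : Disjoint N D) :
    Set.InjOn (fun v => insert v D) N := by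
  intro v hv w hw h
  have hvD : v ∉ D := Finset.disjoint_left.1 hN hv
  have h' : v ∈ insert w D := by
    rw [← show insert v D = insert w D from h]
    exact Finset.mem_insert_self v D
  exact (Finset.mem_insert.1 h').resolve_right hvD

/-- The edge set consisting of the edges in `C` and the edges `D ∪ {v}` for `v ∈ N`. -/
def pendantEdges (C : Finset (Finset V)) (D N : Finset V) : Finset (Finset V) :=
  C ∪ N.image fun v => insert v D

variable {C : Finset (Finset V)} {D N : Finset V} {m : ℕ} {i j : V}

lemma adjU_pendantEdges_of_mem_of_mem (hC : ∀ e ∈ C, Disjoint e D) (hN : Disjoint N D)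
    (hi : i ∈ D) (hj : j ∈ D) :
    adjU (pendantEdges C D N) m i j = if i = j then 0 else (N.card : ℝ) / ((m : ℝ) - 1) := by
  have h : (pendantEdges C D N).filter (fun e => i ∈ e ∧ j ∈ e) =
      N.image fun v => insert v D := by
    ext e
    simp only [pendantEdges, Finset.mem_filter, Finset.mem_union]
    constructor
    · rintro ⟨he | he, hie, -⟩
      · exact absurd hi (Finset.disjoint_left.1 (hC e he) hie)
      · exact he
    · intro he
      refine ⟨Or.inr he, ?_⟩
      obtain ⟨v, -, rfl⟩ := Finset.mem_image.1 he
      exact ⟨Finset.mem_insert_of_mem hi, Finset.mem_insert_of_mem hj⟩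
  rw [adjU, h, Finset.card_image_of_injOn (insert_injOn_of_disjoint hN)]

lemma adjU_pendantEdges_of_mem_of_notMem (hC : ∀ e ∈ C, Disjoint e D)
    (hi : i ∈ D) (hj : j ∉ D) :
    adjU (pendantEdges C D N) m i j = if j ∈ N then 1 / ((m : ℝ) - 1) else 0 := by
  have hij : i ≠ j := fun h => hj (h ▸ hi)
  have h : (pendantEdges C D N).filter (fun e => i ∈ e ∧ j ∈ e) =
      if j ∈ N then {insert j D} else ∅ := by
    ext e
    simp only [pendantEdges, Finset.mem_filter, Finset.mem_union]
    constructor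
    · rintro ⟨he | he, hie, hje⟩
      · exact absurd hi (Finset.disjoint_left.1 (hC e he) hie)
      · obtain ⟨v, hv, rfl⟩ := Finset.mem_image.1 he
        obtain rfl := (Finset.mem_insert.1 hje).resolve_right hj
        simp [hv]
    · intro he
      split_ifs at he with hjN
      · obtain rfl := Finset.mem_singleton.1 he
        exact ⟨Or.inr (Finset.mem_image_of_mem _ hjN), Finset.mem_insert_of_mem hi,
          Finset.mem_insert_self _ _⟩
      · simp at he
  rw [adjU, h, if_neg hij]
  split_ifs <;> simp

lemma adjU_pendantEdges_of_notMem_of_notMem (hi : i ∉ D) (hj : j ∉ D) :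
    adjU (pendantEdges C D N) m i j = adjU C m i j := by
  unfold adjU
  split_ifs with hij
  · rfl
  · congr 3
    ext e
    simp only [pendantEdges, Finset.mem_filter, Finset.mem_union]
    refine ⟨?_, fun h => ⟨Or.inl h.1, h.2⟩⟩
    rintro ⟨he | he, hie, hje⟩
    · exact ⟨he, hie, hje⟩
    · obtain ⟨v, -, rfl⟩ := Finset.mem_image.1 he
      exact absurd (((Finset.mem_insert.1 hie).resolve_right hi).trans
        ((Finset.mem_insert.1 hje).resolve_right hj).symm) hij

end Pendant

/-- a Godsil–McKay-type switching for `m`-uniform hypergraphs.  Let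
`ρ = {V_1,…,V_k, D}` be a partition of the vertex set with `|D| = m-1`, `|V_p| = 2t`,
satisfying the row-sum condition (1) and the condition (2) on `D`.  Switching the
pendant edges `D ∪ {v}` on every part `V_p` with `|N(D) ∩ V_p| = t` produces a
hypergraph `H_ρ` cospectral with `H`. -/
theorem stmt_10 {V : Type*} [Fintype V] [DecidableEq V]
    (m t k : ℕ) (hm : 2 ≤ m) (ht : 1 ≤ t)
    (E : Finset (Finset V)) (hunif : ∀ e ∈ E, e.card = m)
    (Vp : Fin k → Finset V) (D : Finset V)
    -- `{V_1, …, V_k, D}` is a partition of `V`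
    (hpart₁ : ∀ p q, p ≠ q → Disjoint (Vp p) (Vp q))
    (hpart₂ : ∀ p, Disjoint (Vp p) D)
    (hpart₃ : Finset.univ.biUnion Vp ∪ D = Finset.univ)
    (hD : D.card = m - 1) (hVp : ∀ p, (Vp p).card = 2 * t)
    -- condition (1): constant symmetric block row sums
    (B' : Fin k → Fin k → ℝ)
    (hB' : ∀ p q, ∀ i ∈ Vp p, ∑ l ∈ Vp q, adjU E m i l = B' p q)
    (hB'symm : ∀ p q, B' p q = B' q p)
    -- condition (2)
    (hDedge : ∀ e ∈ E, (e ∩ D).card = 0 ∨ (e ∩ D).card = m - 1)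
    (ND : Finset V) (hND : ND = Finset.univ.filter (fun v => insert v D ∈ E))
    (hNDVp : ∀ p, (ND ∩ Vp p).card = 0 ∨ (ND ∩ Vp p).card = t ∨ (ND ∩ Vp p).card = 2 * t)
    -- the switched hypergraph `H_ρ`
    (Eρ : Finset (Finset V))
    (hEρ : Eρ =
      E.filter (fun e =>
        ¬ ∃ p, (ND ∩ Vp p).card = t ∧ ∃ v ∈ ND ∩ Vp p, e = insert v D)
      ∪ Finset.univ.biUnion (fun p =>
          if (ND ∩ Vp p).card = t then ((Vp p \ ND).image (fun v => insert v D))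
          else ∅)) :
    (adjU E m).charpoly = (adjU Eρ m).charpoly := by
  have hNDD : Disjoint ND D := by
    rw [Finset.disjoint_left]
    intro v hv hvD
    rw [hND, Finset.mem_filter, Finset.insert_eq_of_mem hvD] at hv
    have := hunif D hv.2
    omega
  have hcover : ∀ i, i ∈ D ∨ ∃ p, i ∈ Vp p := by
    intro i
    have := hpart₃ ▸ Finset.mem_univ i
    simpa [or_comm] using this
  have huniq : ∀ {p q v}, v ∈ Vp p → v ∈ Vp q → p = q := by
    intro p q v hp hq
    by_contra hne
    exact Finset.disjoint_left.1 (hpart₁ p q hne) hp hq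
  have hnot : ∀ {p i}, i ∈ Vp p → i ∉ D := fun {p _} hi => Finset.disjoint_left.1 (hpart₂ p) hi
  set C := E.filter fun e => Disjoint e D with hCdef
  have hC : ∀ e ∈ C, Disjoint e D := fun e he => (Finset.mem_filter.1 he).2
  let W : Fin k → Finset V := fun p =>
    if (ND ∩ Vp p).card = t then Vp p \ ND else ND ∩ Vp p
  have hWV : ∀ p, W p ⊆ Vp p := by
    intro p
    simp only [W]
    split_ifs
    · exact Finset.sdiff_subset
    · exact Finset.inter_subset_right
  have hWcard : ∀ p, (W p).card = (ND ∩ Vp p).card := by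
    intro p
    simp only [W]
    split_ifs with h
    · have := Finset.card_sdiff_add_card_inter (Vp p) ND
      rw [Finset.inter_comm, hVp] at this
      omega
    · rfl
  set N' := Finset.univ.biUnion W with hN'
  have hN'D : Disjoint N' D := by
    rw [hN', Finset.disjoint_biUnion_left]
    exact fun p _ => Finset.disjoint_of_subset_left (hWV p) (hpart₂ p)
  have hmemN' : ∀ {p j}, j ∈ Vp p → (j ∈ N' ↔ j ∈ W p) := by
    intro p j hj
    simp only [hN', Finset.mem_biUnion, Finset.mem_univ, true_and]
    exact ⟨fun ⟨q, hq⟩ => huniq (hWV q hq) hj ▸ hq, fun h => ⟨p, h⟩⟩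
  have hND_eq : ND = Finset.univ.biUnion fun p => ND ∩ Vp p := by
    ext v
    simp only [Finset.mem_biUnion, Finset.mem_univ, true_and, Finset.mem_inter]
    exact ⟨fun hv => ((hcover v).resolve_left (Finset.disjoint_left.1 hNDD hv)).imp
      fun p hp => ⟨hv, hp⟩, fun ⟨_, hv, _⟩ => hv⟩
  have hcard : N'.card = ND.card := by
    rw [hND_eq, hN', Finset.card_biUnion, Finset.card_biUnion]
    · exact Finset.sum_congr rfl fun p _ => hWcard p
    · exact fun p _ q _ hpq => Finset.disjoint_of_subset_left Finset.inter_subset_right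
        (Finset.disjoint_of_subset_right Finset.inter_subset_right (hpart₁ p q hpq))
    · exact fun p _ q _ hpq => Finset.disjoint_of_subset_left (hWV p)
        (Finset.disjoint_of_subset_right (hWV q) (hpart₁ p q hpq))
  have hE : E = pendantEdges C D ND := by
    ext e
    simp only [pendantEdges, Finset.mem_union, hCdef, Finset.mem_filter, Finset.mem_image]
    constructor
    · intro he
      rcases hDedge e he with h | h
      · exact Or.inl ⟨he, Finset.disjoint_iff_inter_eq_empty.2 (Finset.card_eq_zero.1 h)⟩
      · right
        have hDe : D ⊆ e := Finset.inter_eq_right.1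
          (Finset.eq_of_subset_of_card_le Finset.inter_subset_right (by omega))
        have h1 : (e \ D).card = 1 := by
          rw [Finset.card_sdiff_of_subset hDe, hunif e he]
          omega
        obtain ⟨v, hv⟩ := Finset.card_eq_one.1 h1
        have hev : insert v D = e := by
          rw [Finset.insert_eq, ← hv, Finset.sdiff_union_of_subset hDe]
        exact ⟨v, by simp [hND, hev, he], hev⟩
    · rintro (h | ⟨v, hv, rfl⟩)
      · exact h.1
      · rw [hND] at hv
        exact (Finset.mem_filter.1 hv).2
  have hDne : D.Nonempty := Finset.card_pos.1 (by omega)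
  have hEρ' : Eρ = pendantEdges C D N' := by
    ext e
    rw [hEρ]
    simp only [Finset.mem_union, Finset.mem_filter, Finset.mem_biUnion, Finset.mem_univ,
      true_and, pendantEdges, Finset.mem_image, hN']
    constructor
    · rintro (⟨he, hne⟩ | ⟨p, hp⟩)
      · rw [hE] at he
        rcases Finset.mem_union.1 he with hCe | hNe
        · exact Or.inl hCe
        · obtain ⟨v, hv, rfl⟩ := Finset.mem_image.1 hNe
          obtain ⟨p, hvp⟩ := (hcover v).resolve_left (Finset.disjoint_left.1 hNDD hv)
          have hvi := Finset.mem_inter.2 ⟨hv, hvp⟩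
          have hp : (ND ∩ Vp p).card ≠ t := fun h => hne ⟨p, h, v, hvi, rfl⟩
          exact Or.inr ⟨v, ⟨p, by simpa only [W, if_neg hp] using hvi⟩, rfl⟩
      · split_ifs at hp with ht'
        · obtain ⟨v, hv, rfl⟩ := Finset.mem_image.1 hp
          exact Or.inr ⟨v, ⟨p, by simpa only [W, if_pos ht'] using hv⟩, rfl⟩
        · simp at hp
    · rintro (hCe | ⟨v, ⟨p, hv⟩, rfl⟩)
      · refine Or.inl ⟨(Finset.mem_filter.1 hCe).1, ?_⟩
        rintro ⟨p, -, v, -, rfl⟩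
        obtain ⟨d, hd⟩ := hDne
        exact Finset.disjoint_left.1 (hC _ hCe) (Finset.mem_insert_of_mem hd) hd
      · have hvp := hWV p hv
        by_cases ht' : (ND ∩ Vp p).card = t
        · simp only [W, if_pos ht'] at hv
          exact Or.inr ⟨p, by rw [if_pos ht']; exact Finset.mem_image_of_mem _ hv⟩
        · simp only [W, if_neg ht'] at hv
          have hvN := (Finset.mem_inter.1 hv).1
          refine Or.inl ⟨?_, ?_⟩
          · rw [hND] at hvN
            exact (Finset.mem_filter.1 hvN).2
          · rintro ⟨q, hq, w, hw, hvw⟩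
            obtain rfl := insert_injOn_of_disjoint hNDD hvN (Finset.mem_inter.1 hw).1 hvw
            exact ht' (huniq hvp (Finset.mem_inter.1 hw).2 ▸ hq)
  have ht0 : (t : ℝ) ≠ 0 := by positivity
  refine charpoly_eq_of_gm_switching (c := (t : ℝ)⁻¹) hpart₁ hpart₂ hcover ?_ (adjU_comm E m)
    (adjU_comm Eρ m) B' hB' hB'symm ?_ ?_ ?_
  · intro p
    rw [hVp]
    push_cast
    field_simp
  · intro i hi j hj
    rw [hE, hEρ', adjU_pendantEdges_of_mem_of_mem hC hN'D hi hj,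
      adjU_pendantEdges_of_mem_of_mem hC hNDD hi hj, hcard]
  · intro i hi j hj
    rw [hE, hEρ', adjU_pendantEdges_of_notMem_of_notMem hi hj,
      adjU_pendantEdges_of_notMem_of_notMem hi hj]
  · intro i hi p j hj
    have hsum : ∑ l ∈ Vp p, adjU E m i l = (ND ∩ Vp p).card * (1 / ((m : ℝ) - 1)) := by
      rw [hE, Finset.sum_congr rfl fun l hl =>
        adjU_pendantEdges_of_mem_of_notMem hC hi (hnot hl), ← Finset.sum_filter,
        Finset.filter_mem_eq_inter, Finset.inter_comm, Finset.sum_const, nsmul_eq_mul]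
    rw [hsum, hE, hEρ', adjU_pendantEdges_of_mem_of_notMem hC hi (hnot hj),
      adjU_pendantEdges_of_mem_of_notMem hC hi (hnot hj)]
    simp only [hmemN' hj, W]
    rcases hNDVp p with h | h | h
    · have hjN : j ∉ ND := fun hjN => by
        have := Finset.card_pos.2 ⟨j, Finset.mem_inter.2 ⟨hjN, hj⟩⟩
        omega
      have h0 : (0 : ℕ) ≠ t := by omega
      simp [h, h0, hjN]
    · simp only [h, if_true, Finset.mem_sdiff, hj, true_and]
      rw [inv_mul_cancel_left₀ ht0]
      by_cases hjN : j ∈ ND <;> simp [hjN]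
    · have hsub : ND ∩ Vp p = Vp p :=
        Finset.eq_of_subset_of_card_le Finset.inter_subset_right (by rw [h, hVp])
      have hjN : j ∈ ND := (Finset.mem_inter.1 (hsub.symm ▸ hj)).1
      have h2 : 2 * t ≠ t := by omega
      simp only [hsub, hVp, if_neg h2, hj, hjN, if_true]
      push_cast
      field_simp
      ring
end

section
/- Let s ≥ 1, n ≥ 3, and m = 2s. The adjacency eigenvalues of the s-loose cycle C^{(2s)}_{L(s;n)} are −2/(2s−1) with multiplicity n(s−1), and (2/(2s−1))·(s−1+s·cos(2πi/n)) with multiplicity one for each i = 1,2,…,n; equivalently, the characteristic polynomial of its adjacency matrix is (x + 2/(2s−1))^{n(s−1)} · Π_{i=1}^{n} ( x − (2/(2s−1))(s−1+s·cos(2πi/n)) ). -/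
open scoped BigOperators
open Polynomial

/-- Edge set of the generalized `s`-loose cycle `C^(m)_{L(s;n)}` on the vertex set
`ZMod (n(m-s))` (vertices `1,…,n(m-s)` read cyclically): the `n` edges
`{i(m-s)+1, …, i(m-s)+m}` for `i = 0,…,n-1`, where the last edge wraps around,
i.e. it is `{n(m-s)-(m-s)+1, …, n(m-s)} ∪ {1,…,s}`. -/
def looseCycleEdges (N n m s : ℕ) : Finset (Finset (ZMod N)) :=
  (Finset.range n).image
    (fun i => (Finset.range m).image (fun j => ((i * (m - s) + j + 1 : ℕ) : ZMod N)))

namespace LooseCycle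

open Matrix Finset

section Circulant

variable {n : ℕ} [NeZero n]

lemma stdAddChar_add_stdAddChar_neg (k : ZMod n) :
    ZMod.stdAddChar k + ZMod.stdAddChar (-k) =
      ((2 * Real.cos (2 * Real.pi * (k.val : ℝ) / (n : ℝ)) : ℝ) : ℂ) := by
  have h : ((k.val : ℤ) : ZMod n) = k := by simp
  have h' : ((-(k.val : ℤ) : ℤ) : ZMod n) = -k := by simp
  rw [← h', ← congrArg ZMod.stdAddChar h, ZMod.stdAddChar_coe, ZMod.stdAddChar_coe]
  push_cast
  rw [Complex.cos]
  ring_nf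

/-- The circulant matrix `a (2 + S + S⁻¹)`, where `S` is the cyclic shift on `ZMod n`. -/
def cycleCirculant (n : ℕ) (a : ℝ) : Matrix (ZMod n) (ZMod n) ℝ :=
  fun e f => a * (2 * (if e = f then 1 else 0) + (if e = f + 1 then 1 else 0) +
    (if f = e + 1 then 1 else 0))

/-- The discrete Fourier matrix diagonalises `cycleCirculant`. -/
lemma charpoly_cycleCirculant (a : ℝ) :
    (cycleCirculant n a).charpoly = ∏ k : ZMod n,
      (X - C (a * (2 + 2 * Real.cos (2 * Real.pi * (k.val : ℝ) / (n : ℝ))))) := by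
  set d : ZMod n → ℝ := fun k => a * (2 + 2 * Real.cos (2 * Real.pi * (k.val : ℝ) / (n : ℝ)))
    with hd
  let F : Matrix (ZMod n) (ZMod n) ℂ := fun e k => ZMod.stdAddChar (e * k)
  let G : Matrix (ZMod n) (ZMod n) ℂ := fun k e => (n : ℂ)⁻¹ * ZMod.stdAddChar (-(e * k))
  have hn : (n : ℂ) ≠ 0 := by exact_mod_cast NeZero.ne n
  have hGF : G * F = 1 := by
    ext k l
    have h : ∀ e : ZMod n, G k e * F e l = (n : ℂ)⁻¹ * ZMod.stdAddChar (e * (l - k)) := by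
      intro e
      simp only [F, G]
      rw [mul_assoc, ← AddChar.map_add_eq_mul]
      congr 2
      ring
    rw [Matrix.mul_apply, Finset.sum_congr rfl fun e _ => h e, ← Finset.mul_sum,
      AddChar.sum_mulShift _ (ZMod.isPrimitive_stdAddChar n), Matrix.one_apply]
    by_cases hkl : k = l
    · simp [hkl, hn]
    · simp [hkl, sub_eq_zero, Ne.symm hkl]
  have hFG : F * G = 1 := mul_eq_one_comm.mp hGF
  have hMF : (cycleCirculant n a).map (algebraMap ℝ ℂ) * F =
      F * diagonal (fun k => (d k : ℂ)) := by
    ext e k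
    rw [Matrix.mul_apply, Matrix.mul_diagonal]
    have h : ∀ f : ZMod n, (cycleCirculant n a).map (algebraMap ℝ ℂ) e f * F f k =
        a * (2 * (if e = f then F f k else 0) + (if f = e - 1 then F f k else 0) +
          (if f = e + 1 then F f k else 0)) := by
      intro f
      have h1 : e = f + 1 ↔ f = e - 1 := by
        rw [eq_sub_iff_add_eq, eq_comm]
      simp only [cycleCirculant, Matrix.map_apply, h1]
      split_ifs <;> simp <;> ring
    rw [Finset.sum_congr rfl fun f _ => h f, ← Finset.mul_sum, Finset.sum_add_distrib,
      Finset.sum_add_distrib, ← Finset.mul_sum]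
    simp only [Finset.sum_ite_eq, Finset.sum_ite_eq', Finset.mem_univ, if_true]
    have h1 : F (e - 1) k = F e k * ZMod.stdAddChar (-k) := by
      simp only [F]
      rw [← AddChar.map_add_eq_mul]
      congr 1
      ring
    have h2 : F (e + 1) k = F e k * ZMod.stdAddChar k := by
      simp only [F]
      rw [← AddChar.map_add_eq_mul]
      congr 1
      ring
    have h3 : (d k : ℂ) = a * (2 + (ZMod.stdAddChar k + ZMod.stdAddChar (-k))) := by
      rw [stdAddChar_add_stdAddChar_neg, hd]
      push_cast
      ring
    rw [h1, h2, h3]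
    ring
  have hM : (cycleCirculant n a).map (algebraMap ℝ ℂ) =
      F * (diagonal (fun k => (d k : ℂ)) * G) := by
    rw [← Matrix.mul_assoc, ← hMF, Matrix.mul_assoc, hFG, Matrix.mul_one]
  apply Polynomial.map_injective (algebraMap ℝ ℂ) (algebraMap ℝ ℂ).injective
  rw [← Matrix.charpoly_map, hM, Matrix.charpoly_mul_comm, Matrix.mul_assoc, hGF,
    Matrix.mul_one, Matrix.charpoly_diagonal, Polynomial.map_prod]
  refine Finset.prod_congr rfl fun k _ => ?_
  rw [Polynomial.map_sub, Polynomial.map_X, Polynomial.map_C]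
  rfl

end Circulant

lemma prod_zmod_val {M : Type*} [CommMonoid M] {n : ℕ} [NeZero n] (g : ℕ → M) (hg : g n = g 0) :
    ∏ k : ZMod n, g k.val = ∏ i ∈ Finset.Icc 1 n, g i := by
  have h1 : ∏ k : ZMod n, g k.val = ∏ i ∈ Finset.range n, g i := by
    refine Finset.prod_bij' (fun k _ => k.val) (fun i _ => (i : ZMod n)) ?_ ?_ ?_ ?_ ?_
    · intro k _
      simpa using ZMod.val_lt k
    · simp
    · simp
    · intro i hi
      exact ZMod.val_cast_of_lt (Finset.mem_range.mp hi)
    · simp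
  obtain ⟨k, rfl⟩ := Nat.exists_eq_succ_of_ne_zero (NeZero.ne n)
  rw [h1, Finset.prod_range_succ', ← hg, Finset.range_eq_Ico, Finset.prod_Ico_add' g,
    ← Finset.prod_Ico_succ_top (by omega)]
  rfl

/-- The block of length `s`, indexed by `ZMod n`, containing the vertex `v`. -/
def blk (s n N : ℕ) (v : ZMod N) : ZMod n := (((v - 1).val / s : ℕ) : ZMod n)

section Blocks

variable {s n N : ℕ}

lemma blk_natCast_add_one (hN : N = n * s) (t : ℕ) :
    blk s n N ((t + 1 : ℕ) : ZMod N) = ((t / s : ℕ) : ZMod n) := by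
  subst hN
  rw [blk, Nat.cast_add, Nat.cast_one, add_sub_cancel_right, ZMod.val_natCast, mul_comm n s,
    Nat.mod_mul_right_div_self, ZMod.natCast_mod]

lemma card_blk_eq [NeZero n] [NeZero N] (hs : 1 ≤ s) (hN : N = n * s) (b : ZMod n) :
    #{v : ZMod N | blk s n N v = b} = s := by
  have hlt : ∀ j < s, b.val * s + j < N := by
    intro j hj
    have := Nat.mul_le_mul_right s (Nat.succ_le_of_lt (ZMod.val_lt b))
    rw [Nat.succ_mul] at this
    omega
  have h : ({v : ZMod N | blk s n N v = b} : Finset (ZMod N)) =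
      (Finset.range s).image (fun j => ((b.val * s + j + 1 : ℕ) : ZMod N)) := by
    ext v
    simp only [Finset.mem_filter, Finset.mem_univ, true_and, Finset.mem_image, Finset.mem_range]
    constructor
    · intro h
      refine ⟨(v - 1).val % s, Nat.mod_lt _ hs, ?_⟩
      have hlt' : (v - 1).val / s < n := by
        rw [Nat.div_lt_iff_lt_mul hs, ← hN]
        exact ZMod.val_lt _
      have : b.val = (v - 1).val / s := by
        rw [← h, blk, ZMod.val_cast_of_lt hlt']
      rw [this, Nat.div_add_mod']
      simp
    · rintro ⟨j, hj, rfl⟩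
      rw [blk_natCast_add_one hN, add_comm, Nat.add_mul_div_right _ _ hs, Nat.div_eq_of_lt hj]
      simp
  rw [h, Finset.card_image_of_injOn, Finset.card_range]
  intro i hi j hj hij
  simp only [Nat.cast_add, Nat.cast_one, add_left_inj, add_right_inj] at hij
  have := congrArg ZMod.val hij
  have hi' := hlt i (by simpa using hi)
  have hj' := hlt j (by simpa using hj)
  rwa [ZMod.val_cast_of_lt (by omega), ZMod.val_cast_of_lt (by omega)] at this

lemma mem_edge_iff [NeZero N] (hs : 1 ≤ s) (hN : N = n * s) (i : ℕ) (v : ZMod N) :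
    v ∈ (Finset.range (2 * s)).image (fun j => ((i * s + j + 1 : ℕ) : ZMod N)) ↔
      blk s n N v = i ∨ blk s n N v = i + 1 := by
  simp only [Finset.mem_image, Finset.mem_range]
  have key : ∀ k : ℕ, blk s n N v = (k : ZMod n) →
      ((k * s + (v - 1).val % s + 1 : ℕ) : ZMod N) = v := by
    intro k hk
    have h1 : k * s ≡ (v - 1).val / s * s [MOD n * s] :=
      Nat.ModEq.mul_right' s ((ZMod.natCast_eq_natCast_iff _ _ _).mp hk.symm)
    rw [← hN, ← ZMod.natCast_eq_natCast_iff] at h1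
    rw [Nat.cast_add, Nat.cast_add, h1, ← Nat.cast_add, Nat.div_add_mod']
    simp
  have hmod : (v - 1).val % s < s := Nat.mod_lt _ hs
  constructor
  · rintro ⟨j, hj, rfl⟩
    rw [blk_natCast_add_one hN, add_comm (i * s), Nat.add_mul_div_right _ _ hs]
    rcases lt_or_ge j s with h | h
    · left
      rw [Nat.div_eq_of_lt h]
      simp
    · right
      rw [Nat.div_eq_of_lt_le (k := 1) (by omega) (by omega)]
      push_cast
      ring
  · rintro (h | h)
    · exact ⟨(v - 1).val % s, by omega, key i h⟩
    · refine ⟨s + (v - 1).val % s, by omega, ?_⟩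
      have := key (i + 1) (by exact_mod_cast h)
      rwa [Nat.succ_mul, add_assoc (i * s)] at this

/-- The edge of the `s`-loose cycle made of the two consecutive blocks `e` and `e + 1`. -/
def edge (s n N : ℕ) [NeZero N] (e : ZMod n) : Finset (ZMod N) :=
  {v | blk s n N v = e ∨ blk s n N v = e + 1}

lemma looseCycleEdges_eq [NeZero n] [NeZero N] (hs : 1 ≤ s) (hN : N = n * s) :
    looseCycleEdges N n (2 * s) s = Finset.univ.image (edge s n N) := by
  have hms : 2 * s - s = s := by omega
  have h : ∀ i : ℕ, (Finset.range (2 * s)).image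
      (fun j => ((i * (2 * s - s) + j + 1 : ℕ) : ZMod N)) = edge s n N (i : ZMod n) := by
    intro i
    ext v
    rw [hms, mem_edge_iff hs hN]
    simp [edge]
  rw [looseCycleEdges]
  simp only [h]
  ext t
  simp only [Finset.mem_image, Finset.mem_range, Finset.mem_univ, true_and]
  constructor
  · rintro ⟨i, -, rfl⟩
    exact ⟨_, rfl⟩
  · rintro ⟨e, rfl⟩
    exact ⟨e.val, ZMod.val_lt e, by simp⟩

lemma one_ne_zero_zmod (hn : 3 ≤ n) : (1 : ZMod n) ≠ 0 := by
  have : Fact (1 < n) := ⟨by omega⟩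
  exact one_ne_zero

lemma two_ne_zero_zmod (hn : 3 ≤ n) : (2 : ZMod n) ≠ 0 := by
  intro h
  have h2 : ((2 : ℕ) : ZMod n) = 0 := by exact_mod_cast h
  rw [ZMod.natCast_eq_zero_iff] at h2
  have := Nat.le_of_dvd (by norm_num) h2
  omega

lemma edge_injective [NeZero n] [NeZero N] (hs : 1 ≤ s) (hn : 3 ≤ n) (hN : N = n * s) :
    Function.Injective (edge s n N) := by
  have hsurj : ∀ b : ZMod n, ∃ v, blk s n N v = b := by
    intro b
    have : 0 < #{v : ZMod N | blk s n N v = b} := by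
      rw [card_blk_eq hs hN]
      exact hs
    obtain ⟨v, hv⟩ := Finset.card_pos.mp this
    exact ⟨v, by simpa using hv⟩
  intro e f hef
  obtain ⟨u, hu⟩ := hsurj e
  obtain ⟨v, hv⟩ := hsurj (e + 1)
  have h1 : u ∈ edge s n N f := by
    rw [← hef]
    simp [edge, hu]
  have h2 : v ∈ edge s n N f := by
    rw [← hef]
    simp [edge, hv]
  simp only [edge, Finset.mem_filter, Finset.mem_univ, true_and, hu, hv] at h1 h2
  rcases h1 with h1 | h1
  · exact h1
  · rcases h2 with h2 | h2
    · exact absurd (by linear_combination h2 - h1) (two_ne_zero_zmod hn)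
    · exact add_right_cancel h2

/-- Incidence between the blocks and the edges. -/
def blockInc (n : ℕ) (b e : ZMod n) : ℝ := (if b = e then 1 else 0) + (if b = e + 1 then 1 else 0)

lemma blockInc_eq_ite (hn : 3 ≤ n) (b e : ZMod n) :
    blockInc n b e = if b = e ∨ b = e + 1 then 1 else 0 := by
  have h := one_ne_zero_zmod hn
  unfold blockInc
  by_cases h1 : b = e
  · subst h1
    simp [h]
  · simp [h1]

lemma sum_blockInc [NeZero n] (b : ZMod n) : ∑ e, blockInc n b e = 2 := by
  have h : ∀ e : ZMod n, b = e + 1 ↔ b - 1 = e := fun e => sub_eq_iff_eq_add.symm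
  simp only [blockInc, h, Finset.sum_add_distrib, Finset.sum_ite_eq, Finset.mem_univ, if_true]
  norm_num

/-- Incidence matrix of the `s`-loose cycle. -/
def incMatrix (s n N : ℕ) : Matrix (ZMod N) (ZMod n) ℝ := fun v e => blockInc n (blk s n N v) e

lemma adjU_eq [NeZero n] [NeZero N] (hs : 1 ≤ s) (hn : 3 ≤ n) (hN : N = n * s) :
    adjU (looseCycleEdges N n (2 * s) s) (2 * s) =
      incMatrix s n N * ((1 / (2 * (s : ℝ) - 1)) • (incMatrix s n N)ᵀ) -
        scalar (ZMod N) (2 / (2 * (s : ℝ) - 1)) := by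
  ext u v
  rw [Matrix.mul_smul, Matrix.sub_apply, Matrix.smul_apply, Matrix.mul_apply]
  simp only [Matrix.transpose_apply, incMatrix, adjU]
  by_cases huv : u = v
  · subst huv
    have h : ∀ e, blockInc n (blk s n N u) e * blockInc n (blk s n N u) e =
        blockInc n (blk s n N u) e := by
      intro e
      rw [blockInc_eq_ite hn]
      split_ifs <;> simp
    simp only [h, sum_blockInc]
    simp
    ring
  · have hcard : #{t ∈ looseCycleEdges N n (2 * s) s | u ∈ t ∧ v ∈ t} =
        #{e : ZMod n | u ∈ edge s n N e ∧ v ∈ edge s n N e} := by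
      rw [looseCycleEdges_eq hs hN, Finset.filter_image,
        Finset.card_image_of_injective _ (edge_injective hs hn hN)]
    rw [if_neg huv, hcard, Finset.card_filter]
    simp only [blockInc_eq_ite hn, edge, Finset.mem_filter, Finset.mem_univ, true_and]
    simp only [ite_zero_mul_ite_zero, mul_one]
    simp [huv]
    ring

lemma transpose_mul_incMatrix [NeZero n] [NeZero N] (hs : 1 ≤ s) (hN : N = n * s) (c : ℝ) :
    (c • (incMatrix s n N)ᵀ) * incMatrix s n N = cycleCirculant n (c * s) := by
  ext e f
  rw [Matrix.smul_mul, Matrix.smul_apply, Matrix.mul_apply]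
  simp only [Matrix.transpose_apply, incMatrix]
  rw [← Finset.sum_fiberwise Finset.univ (blk s n N)]
  have h : ∀ b : ZMod n, ∑ v with blk s n N v = b,
      blockInc n (blk s n N v) e * blockInc n (blk s n N v) f =
        s * (blockInc n b e * blockInc n b f) := by
    intro b
    rw [Finset.sum_congr rfl (g := fun _ => blockInc n b e * blockInc n b f),
      Finset.sum_const, card_blk_eq hs hN, nsmul_eq_mul]
    intro v hv
    rw [(Finset.mem_filter.mp hv).2]
  rw [Finset.sum_congr rfl fun b _ => h b, ← Finset.mul_sum]
  have h1 : ∑ b, blockInc n b e * blockInc n b f = blockInc n e f + blockInc n (e + 1) f := by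
    have : ∀ b, blockInc n b e * blockInc n b f =
        (if b = e then blockInc n b f else 0) + (if b = e + 1 then blockInc n b f else 0) := by
      intro b
      rw [blockInc, add_mul, ite_mul, ite_mul, one_mul, zero_mul]
    rw [Finset.sum_congr rfl fun b _ => this b, Finset.sum_add_distrib]
    simp
  rw [h1, cycleCirculant, blockInc, blockInc, smul_eq_mul]
  simp only [add_left_inj, eq_comm (a := e + 1) (b := f)]
  ring

end Blocks

end LooseCycle

/-- for `m = 2s`, the characteristic polynomial of the adjacency matrix of
the `s`-loose cycle `C^(2s)_{L(s;n)}` is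
`(x + 2/(2s-1))^(n(s-1)) ∏_{i=1}^n (x - (2/(2s-1))(s-1+s cos(2πi/n)))`. -/
theorem stmt_15 (s n m N : ℕ) (hs : 1 ≤ s) (hn : 3 ≤ n) (hm : m = 2 * s)
    [NeZero N] (hN : N = n * (m - s)) :
    (adjU (looseCycleEdges N n m s) m).charpoly
      = (X + C (2 / (2 * (s : ℝ) - 1))) ^ (n * (s - 1)) *
        ∏ i ∈ Finset.Icc 1 n,
          (X - C ((2 / (2 * (s : ℝ) - 1)) *
            ((s : ℝ) - 1 + (s : ℝ) * Real.cos (2 * Real.pi * (i : ℝ) / (n : ℝ))))) := by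
  subst hm
  have hN' : N = n * s := by
    rw [hN]
    congr 1
    omega
  have : NeZero n := ⟨by omega⟩
  have hcard : Fintype.card (ZMod N) - Fintype.card (ZMod n) = n * (s - 1) := by
    rw [ZMod.card, ZMod.card, hN', Nat.mul_sub_one]
  have hle : Fintype.card (ZMod n) ≤ Fintype.card (ZMod N) := by
    rw [ZMod.card, ZMod.card, hN']
    exact Nat.le_mul_of_pos_right n hs
  rw [LooseCycle.adjU_eq hs hn hN', Matrix.charpoly_sub_scalar,
    Matrix.charpoly_mul_comm_of_le _ _ hle, hcard, LooseCycle.transpose_mul_incMatrix hs hN',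
    LooseCycle.charpoly_cycleCirculant,
    LooseCycle.prod_zmod_val (fun i : ℕ => X - C (1 / (2 * (s : ℝ) - 1) * s *
      (2 + 2 * Real.cos (2 * Real.pi * (i : ℝ) / (n : ℝ))))),
    Polynomial.mul_comp, Polynomial.pow_comp, Polynomial.X_comp, Polynomial.prod_comp]
  · congr 1
    refine Finset.prod_congr rfl fun i _ => ?_
    rw [Polynomial.sub_comp, Polynomial.X_comp, Polynomial.C_comp, add_sub_assoc, ← C_sub,
      sub_eq_add_neg X, ← C_neg]
    congr 2
    ring
  · have hn0 : (n : ℝ) ≠ 0 := by exact_mod_cast NeZero.ne n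
    simp [hn0]
end

section
/- Let s ≥ 1, n ≥ 3, and m ≥ 2s+1. The adjacency matrix of the s-loose cycle C^{(m)}_{L(s;n)} has: −1/(m−1) as an eigenvalue with multiplicity at least n(m−2s−1); −2/(m−1) as an eigenvalue with multiplicity at least n(s−1); and, for each i = 1,2,…,n, the numbers γ_i^+/(m−1) and γ_i^−/(m−1) as eigenvalues with multiplicity at least one, where γ_i^± = (1/2)·[ m−3+2s·cos(2πi/n) ± √( (m−3+2s·cos(2πi/n))^2 + 8(m−s−1+s·cos(2πi/n)) ) ]. -/
open scoped BigOperators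
open Polynomial

open Matrix Module

/-- If `A - μ` has equal rows along the fibres of `g : ι → κ`, then `μ` is an eigenvalue of `A` with
multiplicity at least `card ι - card κ`. -/
theorem Matrix.card_sub_card_le_rootMultiplicity_charpoly {ι κ K : Type*} [Field K]
    [Fintype ι] [DecidableEq ι] [Fintype κ] (A : Matrix ι ι K) (μ : K) (g : ι → κ)
    (h : ∀ i i', g i = g i' → ∀ j, (A - μ • (1 : Matrix ι ι K)) i j = (A - μ • (1 : Matrix ι ι K)) i' j) :
    Fintype.card ι - Fintype.card κ ≤ A.charpoly.rootMultiplicity μ := by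
  have hfac : Function.FactorsThrough (A - μ • (1 : Matrix ι ι K)).row g := fun i i' hi =>
    funext (h i i' hi)
  obtain ⟨C, hC⟩ := (Function.factorsThrough_iff _).1 hfac
  have hrank : (A - μ • (1 : Matrix ι ι K)).rank ≤ Fintype.card κ := by
    rw [rank_eq_finrank_span_row, hC]
    refine (Submodule.finrank_mono (Submodule.span_mono (Set.range_comp_subset_range g C))).trans ?_
    exact finrank_range_le_card C
  have hle := LinearMap.finrank_eigenspace_le (toLin' A) μ
  rw [charpoly_toLin'] at hle
  refine le_trans ?_ hle
  have hlin : toLin' (A - μ • (1 : Matrix ι ι K)) = toLin' A - μ • (1 : End K (ι → K)) := by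
    rw [map_sub, map_smul, toLin'_one]
    rfl
  rw [End.eigenspace_def, ← hlin]
  have hrn := LinearMap.finrank_range_add_finrank_ker (toLin' (A - μ • (1 : Matrix ι ι K)))
  rw [finrank_pi] at hrn
  rw [Matrix.rank, ← toLin'_apply'] at hrank
  omega

/-- A real number is a root of the characteristic polynomial of a real matrix as soon as it has a
complex eigenvector. -/
theorem Matrix.isRoot_charpoly_of_complex_eigenvector {ι : Type*} [Fintype ι] [DecidableEq ι]
    (A : Matrix ι ι ℝ) (μ : ℝ) (x : ι → ℂ) (hx : x ≠ 0)
    (h : A.map ((↑) : ℝ → ℂ) *ᵥ x = (μ : ℂ) • x) : A.charpoly.IsRoot μ := by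
  rw [IsRoot.def, eval_charpoly]
  apply Complex.ofReal_injective
  rw [← Complex.ofRealHom_eq_coe, RingHom.map_det, Complex.ofReal_zero,
    ← exists_mulVec_eq_zero_iff]
  refine ⟨x, hx, ?_⟩
  have hm : Complex.ofRealHom.mapMatrix (scalar ι μ - A)
      = (μ : ℂ) • (1 : Matrix ι ι ℂ) - A.map ((↑) : ℝ → ℂ) := by
    rw [map_sub, scalar_apply, RingHom.mapMatrix_apply, RingHom.mapMatrix_apply,
      smul_one_eq_diagonal, diagonal_map (by simp)]
    rfl
  rw [hm, sub_mulVec, h, smul_mulVec, one_mulVec, sub_self]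

/-- Vertex-edge incidence matrix of the loose cycle, in coordinates where `(k, j)` is the `j`-th
vertex of the `k`-th block of `d = m - s` consecutive vertices. -/
def looseIncidence (R : Type*) [Zero R] [One R] (n d s : ℕ) :
    Matrix (ZMod n × Fin d) (ZMod n) R :=
  fun u i => if u.1 = i ∨ (u.1 = i + 1 ∧ (u.2 : ℕ) < s) then 1 else 0

/-- The degree of a vertex of the loose cycle in block coordinates. -/
def looseDegree (R : Type*) [AddMonoidWithOne R] {n d : ℕ} (s : ℕ) (u : ZMod n × Fin d) : R :=
  if (u.2 : ℕ) < s then 2 else 1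

/-- The co-degree matrix of the loose cycle in block coordinates, with zero diagonal. -/
def looseCodegree (R : Type*) [CommRing R] (n d s : ℕ) [NeZero n] :
    Matrix (ZMod n × Fin d) (ZMod n × Fin d) R :=
  looseIncidence R n d s * (looseIncidence R n d s)ᵀ - diagonal (looseDegree R s)

theorem ZMod.ne_add_one_self {n : ℕ} (hn : 2 ≤ n) (a : ZMod n) : a ≠ a + 1 := by
  have : Fact (1 < n) := ⟨hn⟩
  simp

theorem sum_looseIncidence_mul {R : Type*} [CommRing R] {n d s : ℕ} [NeZero n] (hn : 2 ≤ n)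
    (u : ZMod n × Fin d) (f : ZMod n → R) :
    ∑ i, looseIncidence R n d s u i * f i
      = f u.1 + if (u.2 : ℕ) < s then f (u.1 - 1) else 0 := by
  have hsplit : ∀ i, looseIncidence R n d s u i * f i
      = (if u.1 = i then f i else 0)
        + if u.1 - 1 = i then (if (u.2 : ℕ) < s then f (u.1 - 1) else 0) else 0 := by
    intro i
    have h1 := ZMod.ne_add_one_self hn i
    by_cases hi : u.1 = i
    · have : u.1 - 1 ≠ i := by rw [hi]; intro h; exact h1 (sub_eq_iff_eq_add.1 h)
      simp only [looseIncidence, hi, true_or, if_true, one_mul, if_neg (hi ▸ this), add_zero]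
    · by_cases hi' : u.1 - 1 = i
      · subst hi'
        simp only [looseIncidence, hi, false_or, sub_add_cancel, true_and, if_true, if_false,
          zero_add, ite_mul, one_mul, zero_mul]
      · have : u.1 ≠ i + 1 := fun h => hi' (sub_eq_iff_eq_add.2 h)
        simp [looseIncidence, hi, hi', this]
  rw [Finset.sum_congr rfl fun i _ => hsplit i, Finset.sum_add_distrib]
  simp

theorem looseIncidence_mul_transpose_diag {R : Type*} [CommRing R] {n d s : ℕ} [NeZero n]
    (hn : 2 ≤ n) (u : ZMod n × Fin d) :
    (looseIncidence R n d s * (looseIncidence R n d s)ᵀ) u u = looseDegree R s u := by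
  rw [mul_apply]
  simp only [transpose_apply]
  rw [sum_looseIncidence_mul hn]
  by_cases h : (u.2 : ℕ) < s <;> simp [looseIncidence, looseDegree, h]
  norm_num

theorem looseCodegree_apply {R : Type*} [CommRing R] {n d s : ℕ} [NeZero n]
    (hn : 2 ≤ n) (u v : ZMod n × Fin d) :
    looseCodegree R n d s u v = if u = v then 0 else
      ((Finset.univ.filter fun i => (u.1 = i ∨ (u.1 = i + 1 ∧ (u.2 : ℕ) < s)) ∧
        (v.1 = i ∨ (v.1 = i + 1 ∧ (v.2 : ℕ) < s))).card : R) := by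
  rw [looseCodegree, Matrix.sub_apply]
  split_ifs with h
  · subst h
    rw [looseIncidence_mul_transpose_diag hn, diagonal_apply_eq, sub_self]
  · rw [diagonal_apply_ne _ h, sub_zero, mul_apply, Finset.card_filter, Nat.cast_sum]
    refine Finset.sum_congr rfl fun i _ => ?_
    simp only [looseIncidence, transpose_apply]
    split_ifs <;> simp_all

section Coordinates

variable {n d N : ℕ} [NeZero n]

/-- The `j`-th vertex of the `k`-th block. -/
def blockVertex (n d N : ℕ) (u : ZMod n × Fin d) : ZMod N := ((u.1.val * d + u.2 + 1 : ℕ) : ZMod N)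

theorem blockVertex_val_add_one (hN : N = n * d) (i : ZMod n) (j : Fin d) :
    blockVertex n d N (i + 1, j) = (((i.val + 1) * d + j + 1 : ℕ) : ZMod N) := by
  have h : ((i + 1).val * d) ≡ (i.val + 1) * d [MOD N] := by
    rw [hN]
    refine Nat.ModEq.mul_right' d ?_
    rw [← ZMod.natCast_eq_natCast_iff]
    simp
  rw [blockVertex, ZMod.natCast_eq_natCast_iff]
  exact (h.add_right _).add_right _

variable [NeZero d] [NeZero N]

theorem blockVertex_bijective (hN : N = n * d) : Function.Bijective (blockVertex n d N) := by
  rw [Fintype.bijective_iff_surjective_and_card]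
  refine ⟨fun v => ?_, by simp [ZMod.card, hN]⟩
  have hd : 0 < d := Nat.pos_of_ne_zero (NeZero.ne d)
  have hq : (v - 1).val / d < n := by
    rw [Nat.div_lt_iff_lt_mul hd, ← hN]
    exact ZMod.val_lt _
  refine ⟨(((v - 1).val / d : ℕ), ⟨(v - 1).val % d, Nat.mod_lt _ hd⟩), ?_⟩
  rw [blockVertex, ZMod.val_cast_of_lt hq, Nat.div_add_mod']
  simp

/-- The vertices of the loose cycle in block coordinates. -/
noncomputable def blockEquiv (hN : N = n * d) : ZMod n × Fin d ≃ ZMod N :=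
  Equiv.ofBijective _ (blockVertex_bijective hN)

theorem mem_looseEdge_iff (hN : N = n * d) {m s : ℕ} (hm : m = d + s) (hsd : s ≤ d)
    (u : ZMod n × Fin d) (i : ZMod n) :
    blockVertex n d N u ∈
        (Finset.range m).image (fun j => ((i.val * d + j + 1 : ℕ) : ZMod N))
      ↔ u.1 = i ∨ (u.1 = i + 1 ∧ (u.2 : ℕ) < s) := by
  have hinj := (blockVertex_bijective (n := n) (d := d) hN).injective
  simp only [Finset.mem_image, Finset.mem_range]
  constructor
  · rintro ⟨j, hj, h⟩
    by_cases hjd : j < d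
    · have : (i, (⟨j, hjd⟩ : Fin d)) = u := hinj h
      exact Or.inl (by rw [← this])
    · have hjd' : j - d < d := by omega
      have : (i + 1, (⟨j - d, hjd'⟩ : Fin d)) = u := by
        apply hinj
        rw [← h, blockVertex_val_add_one hN]
        congr 1
        simp only [add_mul, one_mul]
        omega
      refine Or.inr ?_
      rw [← this]
      exact ⟨rfl, by simp only; omega⟩
  · obtain ⟨k, j⟩ := u
    have := j.isLt
    rintro (rfl | ⟨rfl, hj⟩)
    · exact ⟨j, by omega, rfl⟩
    · refine ⟨d + j, by simp only at hj; omega, ?_⟩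
      rw [blockVertex_val_add_one hN]
      congr 1
      ring

theorem card_filter_looseCycleEdges (hN : N = n * d) {m s : ℕ} (hm : m = d + s)
    (hsd : s < d) (u v : ZMod n × Fin d) :
    ((looseCycleEdges N n m s).filter
        fun e => blockVertex n d N u ∈ e ∧ blockVertex n d N v ∈ e).card
      = (Finset.univ.filter fun i => (u.1 = i ∨ (u.1 = i + 1 ∧ (u.2 : ℕ) < s)) ∧
        (v.1 = i ∨ (v.1 = i + 1 ∧ (v.2 : ℕ) < s))).card := by
  have hmd : m - s = d := by omega
  set edge : ZMod n → Finset (ZMod N) := fun i =>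
    (Finset.range m).image (fun j => ((i.val * d + j + 1 : ℕ) : ZMod N)) with hedge
  have hmem : ∀ w i, blockVertex n d N w ∈ edge i ↔ w.1 = i ∨ (w.1 = i + 1 ∧ (w.2 : ℕ) < s) :=
    mem_looseEdge_iff hN hm hsd.le
  have hinj : Function.Injective edge := by
    intro i i' h
    have h1 := (hmem (i, ⟨s, hsd⟩) i).2 (Or.inl rfl)
    rw [h, hmem] at h1
    simpa using h1
  have himage : looseCycleEdges N n m s = Finset.univ.image edge := by
    ext e
    simp only [looseCycleEdges, hmd, Finset.mem_image, Finset.mem_range, Finset.mem_univ, true_and]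
    constructor
    · rintro ⟨i, hi, rfl⟩
      exact ⟨(i : ZMod n), by simp only [hedge, ZMod.val_cast_of_lt hi]⟩
    · rintro ⟨i, rfl⟩
      exact ⟨i.val, ZMod.val_lt i, rfl⟩
  rw [himage, Finset.filter_image, Finset.card_image_of_injective _ hinj]
  simp only [hmem]

theorem reindex_adjU_looseCycleEdges (hn : 2 ≤ n) (hN : N = n * d) {m s : ℕ} (hm : m = d + s)
    (hsd : s < d) :
    reindex (blockEquiv hN).symm (blockEquiv hN).symm (adjU (looseCycleEdges N n m s) m)
      = ((m : ℝ) - 1)⁻¹ • looseCodegree ℝ n d s := by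
  ext u v
  rw [Matrix.smul_apply, looseCodegree_apply hn, ← card_filter_looseCycleEdges hN hm hsd u v]
  simp only [reindex_apply, submatrix_apply, Equiv.symm_symm, adjU, smul_eq_mul,
    (blockEquiv hN).injective.eq_iff]
  split_ifs
  · simp
  · rw [div_eq_inv_mul]
    rfl

theorem charpoly_adjU_looseCycleEdges (hn : 2 ≤ n) (hN : N = n * d) {m s : ℕ} (hm : m = d + s)
    (hsd : s < d) :
    (adjU (looseCycleEdges N n m s) m).charpoly
      = (((m : ℝ) - 1)⁻¹ • looseCodegree ℝ n d s).charpoly := by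
  rw [← reindex_adjU_looseCycleEdges hn hN hm hsd, charpoly_reindex]

end Coordinates

section Spectrum

variable {n d s : ℕ} [NeZero n]

/-- Two vertices of the same block and of the same degree `δ` have the same row in the co-degree
matrix shifted by `δ`. -/
theorem looseCodegree_sub_apply_eq {c δ : ℝ} {u u' : ZMod n × Fin d} (hfst : u.1 = u'.1)
    (hlt : (u.2 : ℕ) < s ↔ (u'.2 : ℕ) < s)
    (h : looseDegree ℝ s u = δ) (v : ZMod n × Fin d) :
    (c • looseCodegree ℝ n d s - (-δ * c) • (1 : Matrix (ZMod n × Fin d) (ZMod n × Fin d) ℝ)) u v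
      = (c • looseCodegree ℝ n d s - (-δ * c) • (1 : Matrix (ZMod n × Fin d) (ZMod n × Fin d) ℝ)) u' v := by
  have h' : looseDegree ℝ s u' = δ := by simpa [looseDegree, hlt] using h
  have hrow : ∀ w : ZMod n × Fin d, looseDegree ℝ s w = δ →
      (c • looseCodegree ℝ n d s - (-δ * c) • (1 : Matrix (ZMod n × Fin d) (ZMod n × Fin d) ℝ)) w v
        = c * (looseIncidence ℝ n d s * (looseIncidence ℝ n d s)ᵀ) w v := by
    intro w hw
    simp only [looseCodegree, Matrix.sub_apply, Matrix.smul_apply, smul_eq_mul, diagonal_apply, one_apply, hw]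
    split_ifs <;> ring
  rw [hrow u h, hrow u' h']
  simp only [mul_apply, looseIncidence, hfst, hlt]

theorem le_rootMultiplicity_degree_one (c : ℝ) :
    n * (d - s - 1) ≤ (c • looseCodegree ℝ n d s).charpoly.rootMultiplicity (-1 * c) := by
  let g : ZMod n × Fin d → ZMod n × Fin (s + 1) := fun u => (u.1, ⟨min u.2 s, by omega⟩)
  have key := card_sub_card_le_rootMultiplicity_charpoly (c • looseCodegree ℝ n d s) (-1 * c) g ?_
  · refine le_trans (le_of_eq ?_) key
    simp only [Fintype.card_prod, ZMod.card, Fintype.card_fin, ← Nat.mul_sub]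
    congr 1
  · rintro ⟨k, j⟩ ⟨k', j'⟩ h v
    simp only [g, Prod.mk.injEq, Fin.mk.injEq] at h
    obtain ⟨rfl, h⟩ := h
    by_cases hj : (j : ℕ) < s
    · have : j = j' := Fin.ext (by omega)
      rw [this]
    · refine looseCodegree_sub_apply_eq (u := (k, j)) (u' := (k, j')) rfl ?_ ?_ v
      · change (j : ℕ) < s ↔ (j' : ℕ) < s
        omega
      · simp [looseDegree, hj]

theorem le_rootMultiplicity_degree_two (c : ℝ) (hs : 1 ≤ s) (hsd : s < d) :
    n * (s - 1) ≤ (c • looseCodegree ℝ n d s).charpoly.rootMultiplicity (-2 * c) := by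
  let g : ZMod n × Fin d → ZMod n × Fin (d - s + 1) := fun u => (u.1, ⟨u.2 - (s - 1), by omega⟩)
  have key := card_sub_card_le_rootMultiplicity_charpoly (c • looseCodegree ℝ n d s) (-2 * c) g ?_
  · refine le_trans (le_of_eq ?_) key
    simp only [Fintype.card_prod, ZMod.card, Fintype.card_fin, ← Nat.mul_sub]
    congr 1
    omega
  · rintro ⟨k, j⟩ ⟨k', j'⟩ h v
    simp only [g, Prod.mk.injEq, Fin.mk.injEq] at h
    obtain ⟨rfl, h⟩ := h
    by_cases hj : (j : ℕ) < s
    · refine looseCodegree_sub_apply_eq (u := (k, j)) (u' := (k, j')) rfl ?_ ?_ v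
      · change (j : ℕ) < s ↔ (j' : ℕ) < s
        omega
      · simp [looseDegree, hj]
    · have : j = j' := Fin.ext (by omega)
      rw [this]

theorem Fin.sum_ite_val_lt {R : Type*} [CommRing R] {d s : ℕ} (hsd : s ≤ d) (a b : R) :
    ∑ j : Fin d, (if (j : ℕ) < s then a else b) = s * a + (d - s) * b := by
  rw [Fin.sum_univ_eq_sum_range (fun j => if j < s then a else b) d,
    ← Finset.sum_range_add_sum_Ico _ hsd,
    Finset.sum_congr rfl (g := fun _ => a) fun j hj => if_pos (Finset.mem_range.1 hj),
    Finset.sum_congr rfl (g := fun _ => b) fun j hj =>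
      if_neg (not_lt.2 (Finset.mem_Ico.1 hj).1)]
  simp [Nat.cast_sub hsd]

theorem sum_looseIncidence_transpose_mul (hn : 2 ≤ n) (hsd : s ≤ d) (ψ : AddChar (ZMod n) ℂ)
    (a b : ℂ) (i : ZMod n) :
    ∑ u, looseIncidence ℂ n d s u i * (ψ u.1 * if (u.2 : ℕ) < s then a else b)
      = ψ i * (s * a * (1 + ψ 1) + (d - s) * b) := by
  have hk : ∀ k : ZMod n, ∑ j : Fin d,
      looseIncidence ℂ n d s (k, j) i * (ψ k * if (j : ℕ) < s then a else b)
      = (if k = i then ψ i * (s * a + (d - s) * b) else 0)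
        + if k = i + 1 then ψ i * ψ 1 * (s * a) else 0 := by
    intro k
    have h1 := ZMod.ne_add_one_self hn i
    by_cases hi : k = i
    · subst hi
      simp [looseIncidence, h1, Fin.sum_ite_val_lt hsd]
      ring
    · by_cases hi' : k = i + 1
      · subst hi'
        have := Fin.sum_ite_val_lt hsd (ψ (i + 1) * a) 0
        simp only [looseIncidence, hi, false_or, true_and, ite_mul, one_mul, zero_mul, if_false,
          if_true, zero_add]
        rw [mul_zero, add_zero] at this
        rw [← AddChar.map_add_eq_mul, mul_left_comm, ← this]
        refine Finset.sum_congr rfl fun j _ => ?_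
        split_ifs <;> rfl
      · simp [looseIncidence, hi, hi']
  rw [Fintype.sum_prod_type, Finset.sum_congr rfl fun k _ => hk k, Finset.sum_add_distrib]
  simp only [Finset.sum_ite_eq', Finset.mem_univ, if_true]
  ring

theorem looseCodegree_mulVec (hn : 2 ≤ n) (hsd : s ≤ d) (ψ : AddChar (ZMod n) ℂ) (a b : ℂ)
    (u : ZMod n × Fin d) :
    (looseCodegree ℂ n d s *ᵥ fun v => ψ v.1 * if (v.2 : ℕ) < s then a else b) u
      = ψ u.1 * if (u.2 : ℕ) < s
        then (s * a * (1 + ψ 1) + (d - s) * b) * (1 + ψ (-1)) - 2 * a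
        else (s * a * (1 + ψ 1) + (d - s) * b) - b := by
  rw [looseCodegree, sub_mulVec, ← mulVec_mulVec, Pi.sub_apply, mulVec_diagonal]
  have hy : ((looseIncidence ℂ n d s)ᵀ *ᵥ fun v => ψ v.1 * if (v.2 : ℕ) < s then a else b)
      = fun i => ψ i * (s * a * (1 + ψ 1) + (d - s) * b) :=
    funext fun i => sum_looseIncidence_transpose_mul hn hsd ψ a b i
  rw [hy]
  have hz := sum_looseIncidence_mul (s := s) hn u
    fun i => ψ i * (s * a * (1 + ψ 1) + (d - s) * b)
  rw [mulVec, dotProduct, hz, looseDegree, sub_eq_add_neg u.1, AddChar.map_add_eq_mul]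
  split_ifs <;> ring

theorem isRoot_charpoly_looseCodegree (hn : 2 ≤ n) (hs : 1 ≤ s) (hsd : s < d) (c μ : ℝ)
    (ψ : AddChar (ZMod n) ℂ) (x : ℝ) (hx : ψ 1 + ψ (-1) = 2 * x)
    (hμ : μ ^ 2 - (d + s - 3 + 2 * s * x) * μ - 2 * (d - 1 + s * x) = 0) :
    (c • looseCodegree ℝ n d s).charpoly.IsRoot (μ * c) := by
  have hψ : ψ 1 * ψ (-1) = 1 := by
    rw [← AddChar.map_add_eq_mul, add_neg_cancel, AddChar.map_zero_eq_one]
  have hμ' : (μ : ℂ) ^ 2 - (d + s - 3 + 2 * s * x) * μ - 2 * (d - 1 + s * x) = 0 := by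
    exact_mod_cast congrArg ((↑) : ℝ → ℂ) hμ
  obtain ⟨a, b, hab, ha, hb⟩ : ∃ a b : ℂ, (a ≠ 0 ∨ b ≠ 0) ∧
      (s * a * (1 + ψ 1) + (d - s) * b) * (1 + ψ (-1)) - 2 * a = μ * a ∧
      (s * a * (1 + ψ 1) + (d - s) * b) - b = μ * b := by
    by_cases h : (μ : ℂ) + 2 = 0 ∧ 1 + ψ 1 = 0
    · refine ⟨1, 0, Or.inl one_ne_zero, ?_, ?_⟩ <;> rw [h.2]
      · linear_combination -h.1
      · ring
    · have hc : s * ((μ + 1) * (1 + ψ (-1))) * (1 + ψ 1) + (d - s) * (μ + 2)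
          = ((μ : ℂ) + 1) * (μ + 2) := by
        linear_combination s * (μ + 1) * hψ + s * (μ + 1) * hx - hμ'
      refine ⟨(μ + 1) * (1 + ψ (-1)), μ + 2, ?_, ?_, ?_⟩
      · by_contra! hcon
        refine h ⟨hcon.2, ?_⟩
        have h1 : (μ : ℂ) + 1 ≠ 0 := by
          intro h1
          have : (1 : ℂ) = 0 := by linear_combination hcon.2 - h1
          exact one_ne_zero this
        have h2 := (mul_eq_zero.1 hcon.1).resolve_left h1
        linear_combination ψ 1 * h2 - hψ
      · rw [hc]; ring
      · rw [hc]; ring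
  refine isRoot_charpoly_of_complex_eigenvector _ _
    (fun v => ψ v.1 * if (v.2 : ℕ) < s then a else b) ?_ ?_
  · intro h0
    have h1 := congrFun h0 (0, ⟨0, by omega⟩)
    have h2 := congrFun h0 (0, ⟨s, hsd⟩)
    simp only [AddChar.map_zero_eq_one, one_mul, Pi.zero_apply, if_pos (show 0 < s from hs)] at h1
    simp at h2
    exact hab.elim (fun h => h h1) (fun h => h h2)
  · have hmap : (c • looseCodegree ℝ n d s).map ((↑) : ℝ → ℂ)
        = (c : ℂ) • looseCodegree ℂ n d s := by
      ext u v
      rw [map_apply, Matrix.smul_apply, Matrix.smul_apply, looseCodegree_apply hn, looseCodegree_apply hn]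
      split_ifs <;> simp
    rw [hmap, smul_mulVec]
    ext u
    rw [Pi.smul_apply, Pi.smul_apply, looseCodegree_mulVec hn hsd.le, ha, hb]
    simp only [smul_eq_mul, Complex.ofReal_mul]
    split_ifs <;> ring

end Spectrum

theorem ZMod.exists_addChar_add_eq_two_mul_cos {n : ℕ} [NeZero n] (i : ℕ) :
    ∃ ψ : AddChar (ZMod n) ℂ, ψ 1 + ψ (-1) = 2 * (Real.cos (2 * Real.pi * i / n) : ℝ) := by
  refine ⟨AddChar.mulShift ZMod.stdAddChar (i : ℤ), ?_⟩
  rw [AddChar.mulShift_apply, AddChar.mulShift_apply, mul_one, mul_neg_one, ← Int.cast_neg,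
    ZMod.stdAddChar_coe, ZMod.stdAddChar_coe, Complex.ofReal_cos, Complex.two_cos]
  push_cast
  congr 2 <;> ring

/-- for `m ≥ 2s + 1`, the adjacency matrix of the `s`-loose cycle
`C^(m)_{L(s;n)}` has eigenvalue `-1/(m-1)` with (algebraic) multiplicity at least
`n(m-2s-1)`, eigenvalue `-2/(m-1)` with multiplicity at least `n(s-1)`, and for each
`i = 1,…,n` the numbers `γᵢ⁺/(m-1)` and `γᵢ⁻/(m-1)` are eigenvalues, where
`γᵢ^± = (m-3+2s cos(2πi/n) ± √((m-3+2s cos(2πi/n))² + 8(m-s-1+s cos(2πi/n))))/2`. -/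
theorem stmt_16 (s n m N : ℕ) (hs : 1 ≤ s) (hn : 3 ≤ n) (hm : 2 * s + 1 ≤ m)
    [NeZero N] (hN : N = n * (m - s)) :
    n * (m - 2 * s - 1) ≤
        ((adjU (looseCycleEdges N n m s) m).charpoly.rootMultiplicity
          (-1 / ((m : ℝ) - 1)))
      ∧ n * (s - 1) ≤
        ((adjU (looseCycleEdges N n m s) m).charpoly.rootMultiplicity
          (-2 / ((m : ℝ) - 1)))
      ∧ ∀ i ∈ Finset.Icc 1 n,
          ((adjU (looseCycleEdges N n m s) m).charpoly.IsRoot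
            (((1 : ℝ) / 2) * ((m : ℝ) - 3 + 2 * (s : ℝ) * Real.cos (2 * Real.pi * (i : ℝ) / (n : ℝ))
              + Real.sqrt (((m : ℝ) - 3 + 2 * (s : ℝ) * Real.cos (2 * Real.pi * (i : ℝ) / (n : ℝ))) ^ 2
                + 8 * ((m : ℝ) - (s : ℝ) - 1 + (s : ℝ) * Real.cos (2 * Real.pi * (i : ℝ) / (n : ℝ)))))
              / ((m : ℝ) - 1)))
          ∧ ((adjU (looseCycleEdges N n m s) m).charpoly.IsRoot
            (((1 : ℝ) / 2) * ((m : ℝ) - 3 + 2 * (s : ℝ) * Real.cos (2 * Real.pi * (i : ℝ) / (n : ℝ))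
              - Real.sqrt (((m : ℝ) - 3 + 2 * (s : ℝ) * Real.cos (2 * Real.pi * (i : ℝ) / (n : ℝ))) ^ 2
                + 8 * ((m : ℝ) - (s : ℝ) - 1 + (s : ℝ) * Real.cos (2 * Real.pi * (i : ℝ) / (n : ℝ)))))
              / ((m : ℝ) - 1))) := by
  have hd0 : 0 < m - s := by omega
  have : NeZero n := ⟨by omega⟩
  have : NeZero (m - s) := ⟨hd0.ne'⟩
  have hmd : m = (m - s) + s := by omega
  have hsd : s < m - s := by omega
  have hn2 : 2 ≤ n := by omega
  have hcast : ((m - s : ℕ) : ℝ) = m - s := Nat.cast_sub (by omega)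
  rw [charpoly_adjU_looseCycleEdges hn2 hN hmd hsd]
  simp only [div_eq_mul_inv _ ((m : ℝ) - 1)]
  refine ⟨?_, le_rootMultiplicity_degree_two _ hs hsd, fun i _ => ?_⟩
  · refine le_trans (Nat.mul_le_mul_left n ?_) (le_rootMultiplicity_degree_one _)
    omega
  obtain ⟨ψ, hψ⟩ := ZMod.exists_addChar_add_eq_two_mul_cos (n := n) i
  have hx := Real.neg_one_le_cos (2 * Real.pi * (i : ℝ) / (n : ℝ))
  generalize Real.cos (2 * Real.pi * (i : ℝ) / (n : ℝ)) = x at hψ hx ⊢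
  have hdisc : 0 ≤ ((m : ℝ) - 3 + 2 * s * x) ^ 2 + 8 * ((m : ℝ) - s - 1 + s * x) := by
    have hm' : 2 * (s : ℝ) + 1 ≤ m := by exact_mod_cast hm
    have hsx : -(s : ℝ) ≤ s * x := by nlinarith [(Nat.cast_nonneg s : (0 : ℝ) ≤ s)]
    linarith [sq_nonneg ((m : ℝ) - 3 + 2 * s * x)]
  have hsq := Real.sq_sqrt hdisc
  constructor <;> rw [div_mul_eq_mul_div, one_mul] <;>
    refine isRoot_charpoly_looseCodegree hn2 hs hsd _ _ ψ x hψ ?_ <;> rw [hcast] <;>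
    linear_combination (1 / 4 : ℝ) * hsq
end
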